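/- Fix p ≥ 2n−1 and set Λ_p = sup{λ_{1,p}(γ) : γ ∈ R_h}. Then there exists a curve α ∈ R_h^+ such that λ_{1,p}(α) = Λ_p and such that u∘α is monotonically increasing over [0,1]. -/

import Mathlib

open Set MeasureTheory Filter Topology

noncomputable section

/-- The closed quarter plane `P`. -/
def Pset : Set (ℝ × ℝ) := {z | 0 ≤ z.1 ∧ 0 ≤ z.2}

/-- The interior `P°` of the quarter plane. -/
def Pint : Set (ℝ × ℝ) := {z | 0 < z.1 ∧ 0 < z.2}

/-- The boundary `∂P` of the quarter plane. -/
def Pbdry : Set (ℝ × ℝ) := {z | (0 ≤ z.1 ∧ 0 ≤ z.2) ∧ (z.1 = 0 ∨ z.2 = 0)}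

/-- `F(x,y) = c_n x^(n-1) y^(n-1)`. -/
def Fvol (n : ℕ) (cn : ℝ) (z : ℝ × ℝ) : ℝ := cn * z.1 ^ (n - 1) * z.2 ^ (n - 1)

/-- Euclidean speed of a curve at `t`, computed with derivatives within `s`. -/
def gSpeedOn (s : Set ℝ) (α : ℝ → ℝ × ℝ) (t : ℝ) : ℝ :=
  Real.sqrt ((derivWithin (fun u => (α u).1) s t) ^ 2 + (derivWithin (fun u => (α u).2) s t) ^ 2)

/-- Euclidean speed of a curve defined on `[0,1]`. -/
def gSpeed (α : ℝ → ℝ × ℝ) : ℝ → ℝ := gSpeedOn (Icc 0 1) α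

/-- Euclidean length `L_g` of a curve on `[0,1]`. -/
def Lg (α : ℝ → ℝ × ℝ) : ℝ := ∫ t in (0:ℝ)..1, gSpeed α t

/-- The `h`-speed `|γ'|_h = F(γ) |γ'|_g`, with derivatives within `s`. -/
def hSpeedOn (n : ℕ) (cn : ℝ) (s : Set ℝ) (α : ℝ → ℝ × ℝ) (t : ℝ) : ℝ :=
  Fvol n cn (α t) * gSpeedOn s α t

/-- The `h`-speed for curves defined on `[0,1)`. -/
def hSpeed (n : ℕ) (cn : ℝ) (α : ℝ → ℝ × ℝ) : ℝ → ℝ := hSpeedOn n cn (Ico 0 1) α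

/-- The `h`-length `L_h` of a curve on `[0,1)`. -/
def Lh (n : ℕ) (cn : ℝ) (α : ℝ → ℝ × ℝ) : ℝ := ∫ t in (0:ℝ)..1, hSpeed n cn α t

/-- Numerator integrand of the `g`-Rayleigh quotient:
`|w'(t)|^p F(α t) |α'(t)|_g^(1-p)`. -/
def numG (n : ℕ) (cn p : ℝ) (s : Set ℝ) (α : ℝ → ℝ × ℝ) (w : ℝ → ℝ) (t : ℝ) : ℝ :=
  |derivWithin w (Icc 0 1) t| ^ p * Fvol n cn (α t) * gSpeedOn s α t ^ (1 - p)

/-- Denominator integrand of the `g`-Rayleigh quotient: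
`|w(t)|^p F(α t) |α'(t)|_g`. -/
def denG (n : ℕ) (cn p : ℝ) (s : Set ℝ) (α : ℝ → ℝ × ℝ) (w : ℝ → ℝ) (t : ℝ) : ℝ :=
  |w t| ^ p * Fvol n cn (α t) * gSpeedOn s α t

/-- First Dirichlet eigenvalue of the `p`-Laplacian along a curve, `g`-form:
infimum of the Rayleigh quotient over Lipschitz test functions on `[0,1]`
vanishing at `0` (with admissible, i.e. integrable with positive denominator,
Rayleigh quotients). -/
def lambdaGOn (n : ℕ) (cn p : ℝ) (s : Set ℝ) (α : ℝ → ℝ × ℝ) : ℝ :=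
  sInf {q | ∃ w : ℝ → ℝ, (∃ K, LipschitzOnWith K w (Icc 0 1)) ∧ w 0 = 0 ∧
    IntervalIntegrable (numG n cn p s α w) volume 0 1 ∧
    IntervalIntegrable (denG n cn p s α w) volume 0 1 ∧
    (0 < ∫ t in (0:ℝ)..1, denG n cn p s α w t) ∧
    q = (∫ t in (0:ℝ)..1, numG n cn p s α w t) / (∫ t in (0:ℝ)..1, denG n cn p s α w t)}

/-- `λ_{1,p}` in the `g`-form for curves on `[0,1]`. -/
def lambdaG (n : ℕ) (cn p : ℝ) (α : ℝ → ℝ × ℝ) : ℝ := lambdaGOn n cn p (Icc 0 1) α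

/-- Numerator integrand of the `h`-Rayleigh quotient on `[c,d]`:
`|w'(t)|^p F(γ t)^p |γ'(t)|_h^(1-p)`. -/
def numH (n : ℕ) (cn p c d : ℝ) (s : Set ℝ) (γ : ℝ → ℝ × ℝ) (w : ℝ → ℝ) (t : ℝ) : ℝ :=
  |derivWithin w (Icc c d) t| ^ p * Fvol n cn (γ t) ^ p * hSpeedOn n cn s γ t ^ (1 - p)

/-- Denominator integrand of the `h`-Rayleigh quotient: `|w(t)|^p |γ'(t)|_h`. -/
def denH (n : ℕ) (cn p : ℝ) (s : Set ℝ) (γ : ℝ → ℝ × ℝ) (w : ℝ → ℝ) (t : ℝ) : ℝ :=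
  |w t| ^ p * hSpeedOn n cn s γ t

/-- `λ_{1,p}` in the `h`-form for a curve on `[c,d)`, with test functions
Lipschitz on `[c,d]` vanishing at `c`. -/
def lambdaHOn (n : ℕ) (cn p c d : ℝ) (s : Set ℝ) (γ : ℝ → ℝ × ℝ) : ℝ :=
  sInf {q | ∃ w : ℝ → ℝ, (∃ K, LipschitzOnWith K w (Icc c d)) ∧ w c = 0 ∧
    IntervalIntegrable (numH n cn p c d s γ w) volume c d ∧
    IntervalIntegrable (denH n cn p s γ w) volume c d ∧
    (0 < ∫ t in c..d, denH n cn p s γ w t) ∧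
    q = (∫ t in c..d, numH n cn p c d s γ w t) / (∫ t in c..d, denH n cn p s γ w t)}

/-- `λ_{1,p}` in the `h`-form for curves on `[0,1)`. -/
def lambdaH (n : ℕ) (cn p : ℝ) (γ : ℝ → ℝ × ℝ) : ℝ :=
  lambdaHOn n cn p 0 1 (Ico 0 1) γ

/-- The class `𝒞` of `C¹` curves from `(x₀,y₀)` to the boundary, with constant
speed, interior image on `[0,1)`, endpoint away from the origin, and meeting the
boundary orthogonally. -/
def MemC (x0 y0 : ℝ) (α : ℝ → ℝ × ℝ) : Prop :=
  ContDiffOn ℝ 1 α (Icc 0 1) ∧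
  α 0 = (x0, y0) ∧
  (∀ t ∈ Ico (0:ℝ) 1, α t ∈ Pint) ∧
  α 1 ∈ Pbdry ∧ α 1 ≠ ((0 : ℝ), (0 : ℝ)) ∧
  (∀ t ∈ Icc (0:ℝ) 1, gSpeed α t = Lg α) ∧
  ((α 1).1 = 0 → derivWithin (fun u => (α u).2) (Icc 0 1) 1 = 0) ∧
  ((α 1).2 = 0 → derivWithin (fun u => (α u).1) (Icc 0 1) 1 = 0)

/-- The Simons cone curve `σ(t) = (1-t)·(R,R)`. -/
def simonsCurve (R : ℝ) : ℝ → ℝ × ℝ := fun t => ((1 - t) * R, (1 - t) * R)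

/-- The class `R_h`: locally Lipschitz curves on `[0,1)` with image in `P°`,
starting at `(x₀,y₀)`, with essentially bounded `h`-speed, reaching the collapsed
boundary point as `t → 1` (i.e. `x(γ t)·y(γ t) → 0`). -/
def MemRh (n : ℕ) (cn x0 y0 : ℝ) (γ : ℝ → ℝ × ℝ) : Prop :=
  γ 0 = (x0, y0) ∧
  (∀ t ∈ Ico (0:ℝ) 1, γ t ∈ Pint) ∧
  (∀ a ∈ Ico (0:ℝ) 1, ∃ K, LipschitzOnWith K γ (Icc 0 a)) ∧
  (∃ M : ℝ, ∀ᵐ t ∂(volume : Measure ℝ), t ∈ Ico (0:ℝ) 1 → hSpeed n cn γ t ≤ M) ∧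
  Tendsto (fun t => (γ t).1 * (γ t).2) (𝓝[<] (1:ℝ)) (𝓝 0)

/-- The class `R_h^+`: continuous curves on `[0,1]` into `P` ending on `∂P`
whose restriction to `[0,1)` belongs to `R_h`. -/
def MemRhPlus (n : ℕ) (cn x0 y0 : ℝ) (α : ℝ → ℝ × ℝ) : Prop :=
  ContinuousOn α (Icc 0 1) ∧ (∀ t ∈ Icc (0:ℝ) 1, α t ∈ Pset) ∧ α 1 ∈ Pbdry ∧
  MemRh n cn x0 y0 α

/-- The class `R_g`: Lipschitz curves on `[0,1]` from `(x₀,y₀)` to `∂P` with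
interior image on `[0,1)`. -/
def MemRg (x0 y0 : ℝ) (α : ℝ → ℝ × ℝ) : Prop :=
  (∃ K, LipschitzOnWith K α (Icc 0 1)) ∧ α 0 = (x0, y0) ∧ α 1 ∈ Pbdry ∧
  ∀ t ∈ Ico (0:ℝ) 1, α t ∈ Pint

/-- The coordinate `u(x,y) = (x² - y²)/2`. -/
def ucoord (z : ℝ × ℝ) : ℝ := (z.1 ^ 2 - z.2 ^ 2) / 2

/-- The coordinate `v(x,y) = xy`. -/
def vcoord (z : ℝ × ℝ) : ℝ := z.1 * z.2

/-- The coordinate `r = √(u² + v²)`. -/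
def rcoord (z : ℝ × ℝ) : ℝ := Real.sqrt (ucoord z ^ 2 + vcoord z ^ 2)

/-- The class `R_g^*`: simple curves in `R_g` with a.e. constant speed,
`u(α(1)) > 0`, and `v(α(t)) ≥ c(1-t)` for some `c > 0`. -/
def MemRgStar (x0 y0 : ℝ) (α : ℝ → ℝ × ℝ) : Prop :=
  MemRg x0 y0 α ∧ InjOn α (Icc 0 1) ∧
  (∀ᵐ t ∂(volume : Measure ℝ), t ∈ Icc (0:ℝ) 1 → gSpeed α t = Lg α) ∧
  0 < ucoord (α 1) ∧
  ∃ c > (0:ℝ), ∀ t ∈ Icc (0:ℝ) 1, c * (1 - t) ≤ vcoord (α t)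

/-- The push-forward of the measure with density `k` under a primitive of `k` is Lebesgue
measure. -/
theorem map_primitive_withDensity {k : ℝ → ℝ} (hk : Integrable k) (hk0 : ∀ t, 0 ≤ k t)
    (b : ℝ) (hb : 0 ≤ b) :
    ((volume.restrict (Icc 0 b)).withDensity (fun t => ENNReal.ofReal (k t))).map
      (fun t => ∫ r in (0:ℝ)..t, k r) = volume.restrict (Icc 0 (∫ r in (0:ℝ)..b, k r)) := by
  set σ : ℝ → ℝ := fun t => ∫ r in (0:ℝ)..t, k r with hσ
  have hcont : Continuous σ :=
    intervalIntegral.continuous_primitive (fun a b => hk.intervalIntegrable) 0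
  have hdiff : ∀ s t, σ t - σ s = ∫ r in s..t, k r := fun s t =>
    intervalIntegral.integral_interval_sub_left hk.intervalIntegrable hk.intervalIntegrable
  have hmono : Monotone σ := fun s t hst => by
    have := intervalIntegral.integral_nonneg (μ := volume) hst (fun u _ => hk0 u)
    rw [← hdiff] at this
    linarith
  have hσ0 : σ 0 = 0 := by simp [hσ]
  have hfin : IsFiniteMeasure
      ((volume.restrict (Icc 0 b)).withDensity (fun t => ENNReal.ofReal (k t))) := by
    refine isFiniteMeasure_withDensity_ofReal ?_
    exact (hk.restrict (s := Icc 0 b)).2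
  refine Measure.ext_of_Iic _ _ fun c => ?_
  rw [Measure.map_apply hcont.measurable measurableSet_Iic,
    withDensity_apply _ (hcont.measurable measurableSet_Iic),
    Measure.restrict_restrict (hcont.measurable measurableSet_Iic),
    Measure.restrict_apply measurableSet_Iic]
  rcases lt_or_ge c 0 with hc | hc
  · have h1 : σ ⁻¹' Iic c ∩ Icc 0 b = ∅ := by
      ext t
      simp only [mem_inter_iff, mem_preimage, mem_Iic, mem_Icc, mem_empty_iff_false, iff_false]
      rintro ⟨h1, h2, -⟩
      have := hmono h2
      linarith
    have h2 : Iic c ∩ Icc 0 (σ b) = ∅ := by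
      ext t
      simp only [mem_inter_iff, mem_Iic, mem_Icc, mem_empty_iff_false, iff_false]
      rintro ⟨h1, h2, -⟩
      linarith
    rw [h1, h2]
    simp
  · have hcomp : IsCompact (σ ⁻¹' Iic c ∩ Icc 0 b) :=
      isCompact_Icc.inter_left (isClosed_Iic.preimage hcont)
    obtain ⟨T, hT, hTmax⟩ := hcomp.exists_isGreatest ⟨0, by simp [hσ0, hc], le_rfl, hb⟩
    have hset : σ ⁻¹' Iic c ∩ Icc 0 b = Icc 0 T := by
      ext t
      constructor
      · intro ht
        exact ⟨ht.2.1, hTmax ht⟩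
      · intro ht
        exact ⟨(hmono ht.2).trans hT.1, ht.1, ht.2.trans hT.2.2⟩
    have hσT : σ T = min c (σ b) := by
      refine le_antisymm (le_min hT.1 (hmono hT.2.2)) ?_
      by_contra! hlt
      have hmem : min c (σ b) ∈ Icc (σ T) (σ b) := ⟨hlt.le, min_le_right _ _⟩
      obtain ⟨t, ht, hteq⟩ := intermediate_value_Icc hT.2.2 hcont.continuousOn hmem
      have : t ≤ T := hTmax ⟨by simp [hteq], hT.2.1.trans ht.1, ht.2⟩
      have := hmono this
      linarith
    have hset2 : Iic c ∩ Icc 0 (σ b) = Icc 0 (σ T) := by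
      ext t
      simp only [hσT, mem_inter_iff, mem_Iic, mem_Icc, le_min_iff]
      tauto
    rw [hset, hset2, Real.volume_Icc, sub_zero,
      ← ofReal_integral_eq_lintegral_ofReal hk.restrict (Eventually.of_forall hk0),
      integral_Icc_eq_integral_Ioc, ← intervalIntegral.integral_of_le hT.2.1]

theorem lintegral_comp_primitive {k : ℝ → ℝ} (hk : Integrable k) (hkm : Measurable k)
    (hk0 : ∀ t, 0 ≤ k t) (b : ℝ) (hb : 0 ≤ b) {g : ℝ → ENNReal} (hg : Measurable g) :
    ∫⁻ t in Icc 0 b, ENNReal.ofReal (k t) * g (∫ r in (0:ℝ)..t, k r)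
      = ∫⁻ τ in Icc 0 (∫ r in (0:ℝ)..b, k r), g τ := by
  have hcont : Continuous (fun t => ∫ r in (0:ℝ)..t, k r) :=
    intervalIntegral.continuous_primitive (fun a b => hk.intervalIntegrable) 0
  rw [← map_primitive_withDensity hk hk0 b hb, lintegral_map hg hcont.measurable,
    lintegral_withDensity_eq_lintegral_mul _ hkm.ennreal_ofReal
      (g := fun t => g (∫ r in (0:ℝ)..t, k r)) (hg.comp hcont.measurable)]
  rfl

theorem integral_comp_primitive {k : ℝ → ℝ} (hk : Integrable k) (hkm : Measurable k)
    (hk0 : ∀ t, 0 ≤ k t) (b : ℝ) (hb : 0 ≤ b) {g : ℝ → ℝ} (hg : Measurable g) :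
    ∫ t in (0:ℝ)..b, k t * g (∫ r in (0:ℝ)..t, k r)
      = ∫ τ in (0:ℝ)..(∫ r in (0:ℝ)..b, k r), g τ := by
  have hcont : Continuous (fun t => ∫ r in (0:ℝ)..t, k r) :=
    intervalIntegral.continuous_primitive (fun a b => hk.intervalIntegrable) 0
  have hb' : 0 ≤ ∫ r in (0:ℝ)..b, k r := intervalIntegral.integral_nonneg hb (fun u _ => hk0 u)
  rw [intervalIntegral.integral_of_le hb, intervalIntegral.integral_of_le hb',
    ← integral_Icc_eq_integral_Ioc, ← integral_Icc_eq_integral_Ioc,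
    ← map_primitive_withDensity hk hk0 b hb,
    integral_map hcont.aemeasurable hg.aestronglyMeasurable,
    integral_withDensity_eq_integral_toReal_smul hkm.ennreal_ofReal (by simp)]
  simp [ENNReal.toReal_ofReal (hk0 _)]

/-- If every initial integral of `h₁` is at most that of `h₂`, the same holds after multiplying
both by a nonincreasing nonnegative weight. -/
theorem lintegral_mul_antitone_le {h₁ h₂ : ℝ → ENNReal} {ρ : ℝ → ℝ}
    (hh₁ : AEMeasurable h₁ (volume.restrict (Ioo 0 1)))
    (hh₂ : AEMeasurable h₂ (volume.restrict (Ioo 0 1)))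
    (hρm : AEMeasurable ρ (volume.restrict (Ioo 0 1)))
    (hρ : AntitoneOn ρ (Ioo 0 1)) (hρ0 : ∀ t ∈ Ioo (0:ℝ) 1, 0 ≤ ρ t)
    (h : ∀ a ∈ Ioo (0:ℝ) 1, ∫⁻ t in Ioo 0 a, h₁ t ≤ ∫⁻ t in Ioo 0 a, h₂ t) :
    ∫⁻ t in Ioo (0:ℝ) 1, h₁ t * ENNReal.ofReal (ρ t)
      ≤ ∫⁻ t in Ioo (0:ℝ) 1, h₂ t * ENNReal.ofReal (ρ t) := by
  have hone : ∫⁻ t in Ioo 0 (1:ℝ), h₁ t ≤ ∫⁻ t in Ioo 0 (1:ℝ), h₂ t := by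
    have hU : (⋃ m : ℕ, Ioo (0:ℝ) (1 - 1 / (m + 2))) = Ioo 0 1 := by
      ext t
      simp only [mem_iUnion, mem_Ioo]
      constructor
      · rintro ⟨m, h1, h2⟩
        have : (0:ℝ) < 1 / (m + 2) := by positivity
        exact ⟨h1, by linarith⟩
      · rintro ⟨h1, h2⟩
        obtain ⟨m, hm⟩ := exists_nat_one_div_lt (sub_pos.2 h2)
        have : (1:ℝ) / (m + 2) ≤ 1 / (m + 1) := by
          apply one_div_le_one_div_of_le <;> [positivity; linarith]
        exact ⟨m, h1, by linarith⟩
    have hmono : Monotone (fun m : ℕ => Ioo (0:ℝ) (1 - 1 / (m + 2))) := by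
      intro i j hij
      apply Ioo_subset_Ioo_right
      have : (1:ℝ) / (j + 2) ≤ 1 / (i + 2) := by
        apply one_div_le_one_div_of_le
        · positivity
        · have : (i:ℝ) ≤ j := by exact_mod_cast hij
          linarith
      linarith
    rw [← hU, setLIntegral_iUnion_of_directed _ hmono.directed_le]
    refine iSup_le fun m => ?_
    refine (h _ ⟨?_, ?_⟩).trans (lintegral_mono_set ?_)
    · have : (1:ℝ) / (m + 2) < 1 := by
        rw [div_lt_one (by positivity)]
        have : (0:ℝ) ≤ m := Nat.cast_nonneg m
        linarith
      linarith
    · have : (0:ℝ) < 1 / (m + 2) := by positivity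
      linarith
    · exact subset_iUnion (fun m : ℕ => Ioo (0:ℝ) (1 - 1 / (m + 2))) m
  have key : ∀ (g : ℝ → ENNReal), AEMeasurable g (volume.restrict (Ioo 0 1)) →
      ∫⁻ t in Ioo (0:ℝ) 1, g t * ENNReal.ofReal (ρ t)
      = ∫⁻ s in Ioi (0:ℝ), ((volume.restrict (Ioo 0 1)).withDensity g) {t | s < ρ t} := by
    intro g hg
    rw [← lintegral_eq_lintegral_meas_lt]
    · rw [lintegral_withDensity_eq_lintegral_mul₀ hg hρm.ennreal_ofReal]
      rfl
    · refine (withDensity_absolutelyContinuous _ _).ae_le ?_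
      filter_upwards [ae_restrict_mem measurableSet_Ioo] with t ht using hρ0 t ht
    · exact hρm.mono_ac (withDensity_absolutelyContinuous _ _)
  rw [key h₁ hh₁, key h₂ hh₂]
  refine lintegral_mono fun s => ?_
  have hseg : ∃ a ∈ Icc (0:ℝ) 1, ({t | s < ρ t} ∩ Ioo 0 1 : Set ℝ) =ᵐ[volume] Ioo 0 a := by
    rcases ({t | s < ρ t} ∩ Ioo 0 1 : Set ℝ).eq_empty_or_nonempty with he | hne
    · exact ⟨0, by simp, by rw [he]; simp⟩
    · have hbdd : BddAbove ({t | s < ρ t} ∩ Ioo 0 1 : Set ℝ) := ⟨1, fun t ht => ht.2.2.le⟩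
      refine ⟨sSup ({t | s < ρ t} ∩ Ioo 0 1), ⟨?_, ?_⟩, ?_⟩
      · obtain ⟨t, ht⟩ := hne
        exact ht.2.1.le.trans (le_csSup hbdd ht)
      · exact csSup_le hne fun t ht => ht.2.2.le
      · have hsub : Ioo 0 (sSup ({t | s < ρ t} ∩ Ioo 0 1)) ⊆ ({t | s < ρ t} ∩ Ioo 0 1 : Set ℝ) := by
          intro t ht
          obtain ⟨r, hr, htr⟩ := exists_lt_of_lt_csSup hne ht.2
          have ht1 : t ∈ Ioo (0:ℝ) 1 := ⟨ht.1, htr.trans hr.2.2⟩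
          exact ⟨lt_of_lt_of_le hr.1 (hρ ht1 hr.2 htr.le), ht1⟩
        have hsup : ({t | s < ρ t} ∩ Ioo 0 1 : Set ℝ) ⊆ Ioc 0 (sSup ({t | s < ρ t} ∩ Ioo 0 1)) :=
          fun t ht => ⟨ht.2.1, le_csSup hbdd ht⟩
        refine Filter.EventuallyLE.antisymm ?_ hsub.eventuallyLE
        exact hsup.eventuallyLE.trans Ioo_ae_eq_Ioc.symm.le
  obtain ⟨a, ha, hae⟩ := hseg
  have hcalc : ∀ g : ℝ → ENNReal, ((volume.restrict (Ioo 0 1)).withDensity g) {t | s < ρ t}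
      = ∫⁻ t in Ioo 0 a, g t := by
    intro g
    rw [withDensity_apply', Measure.restrict_restrict' measurableSet_Ioo, setLIntegral_congr hae]
  rw [hcalc, hcalc]
  rcases ha.1.eq_or_lt with h0 | h0
  · simp [← h0]
  · rcases ha.2.eq_or_lt with h1 | h1
    · rw [h1]; exact hone
    · exact h a ⟨h0, h1⟩

theorem Real.log_sub_log_le_div {u v d : ℝ} (hd : 0 < d) (hu : d ≤ u) (hv : d ≤ v) :
    Real.log u - Real.log v ≤ |u - v| / d := by
  have hu0 : 0 < u := hd.trans_le hu
  have hv0 : 0 < v := hd.trans_le hv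
  rw [← Real.log_div hu0.ne' hv0.ne']
  calc Real.log (u / v) ≤ u / v - 1 := Real.log_le_sub_one_of_pos (by positivity)
    _ = (u - v) / v := by field_simp
    _ ≤ |u - v| / v := by gcongr; exact le_abs_self _
    _ ≤ |u - v| / d := by gcongr

theorem absolutelyContinuousOnInterval_log {x : ℝ → ℝ} {c : ℝ} (hc : 0 ≤ c)
    (hpos : ∀ t ∈ Icc 0 c, 0 < x t) (hlip : ∃ K, LipschitzOnWith K x (Icc 0 c)) :
    AbsolutelyContinuousOnInterval (fun t => Real.log (x t)) 0 c := by
  obtain ⟨K, hK⟩ := hlip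
  obtain ⟨t₀, ht₀, hmin⟩ := isCompact_Icc.exists_isMinOn ⟨0, left_mem_Icc.2 hc⟩ hK.continuousOn
  have hd := hpos t₀ ht₀
  have : LipschitzOnWith (K / (x t₀).toNNReal) (fun t => Real.log (x t)) (uIcc 0 c) := by
    rw [uIcc_of_le hc]
    refine LipschitzOnWith.of_dist_le_mul fun s hs t ht => ?_
    have h1 := hK.dist_le_mul s hs t ht
    rw [Real.dist_eq] at h1
    have h2 : |Real.log (x s) - Real.log (x t)| ≤ |x s - x t| / x t₀ := by
      rw [abs_le]
      have h3 := Real.log_sub_log_le_div hd (hmin hs) (hmin ht)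
      have h4 := Real.log_sub_log_le_div hd (hmin ht) (hmin hs)
      rw [abs_sub_comm] at h4
      constructor <;> linarith
    rw [Real.dist_eq, NNReal.coe_div, Real.coe_toNNReal _ hd.le]
    calc _ ≤ _ := h2
      _ ≤ (K * dist s t) / x t₀ := by gcongr
      _ = _ := by ring
  exact this.absolutelyContinuousOnInterval

theorem abs_deriv_log_le {x : ℝ → ℝ} {t : ℝ} (h : ∀ᶠ s in 𝓝 t, 0 < x s) :
    |deriv (fun s => Real.log (x s)) t| * x t ≤ |deriv x t| := by
  have ht : 0 < x t := h.self_of_nhds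
  by_cases hx : DifferentiableAt ℝ x t
  · rw [deriv.log hx ht.ne', abs_div, abs_of_pos ht, div_mul_cancel₀ _ ht.ne']
  · have : ¬ DifferentiableAt ℝ (fun s => Real.log (x s)) t := by
      intro hl
      apply hx
      refine (hl.exp).congr_of_eventuallyEq ?_
      filter_upwards [h] with s hs
      rw [Real.exp_log hs]
    rw [deriv_zero_of_not_differentiableAt this]
    simp

/-- A positive locally Lipschitz function `x` on `[0,1)` has a nonincreasing minorant `ξ` with the
same initial value which moves no faster than `x` and for which `ξ / x` is nonincreasing. Here
`-e` is the derivative of `ξ`. -/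
theorem exists_nonincreasing_minorant {x : ℝ → ℝ} (hpos : ∀ t ∈ Ico (0:ℝ) 1, 0 < x t)
    (hlip : ∀ a ∈ Ico (0:ℝ) 1, ∃ K, LipschitzOnWith K x (Icc 0 a)) :
    ∃ e : ℝ → ℝ, Measurable e ∧ (∀ t, 0 ≤ e t) ∧ (∀ t, t ∉ Ioo (0:ℝ) 1 → e t = 0) ∧
      (∀ t ∈ Ioo (0:ℝ) 1, e t ≤ |deriv x t|) ∧ Integrable e ∧
      (∀ t ∈ Ico (0:ℝ) 1, 0 < x 0 - ∫ r in (0:ℝ)..t, e r) ∧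
      (∀ t ∈ Ico (0:ℝ) 1, x 0 - ∫ r in (0:ℝ)..t, e r ≤ x t) ∧
      AntitoneOn (fun t => (x 0 - ∫ r in (0:ℝ)..t, e r) / x t) (Ico 0 1) := by
  have hx0 : 0 < x 0 := hpos 0 (by simp)
  set l : ℝ → ℝ := fun t => Real.log (x t) with hl
  set a : ℝ → ℝ := (Ioo (0:ℝ) 1).indicator (fun t => max (-(deriv l t)) 0) with ha
  set A : ℝ → ℝ := fun t => ∫ r in (0:ℝ)..t, a r with hA
  have ham : Measurable a :=
    ((measurable_deriv l).neg.max measurable_const).indicator measurableSet_Ioo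
  have ha0 : ∀ t, 0 ≤ a t := fun t => indicator_nonneg (fun _ _ => le_max_right _ _) t
  have hac : ∀ c ∈ Ico (0:ℝ) 1, AbsolutelyContinuousOnInterval l 0 c := fun c hc =>
    absolutelyContinuousOnInterval_log hc.1 (fun t ht => hpos t ⟨ht.1, ht.2.trans_lt hc.2⟩)
      (hlip c hc)
  have haeq : ∀ c ∈ Ico (0:ℝ) 1, EqOn (fun t => max (-(deriv l t)) 0) a (Ioc 0 c) := by
    intro c hc t ht
    rw [ha, indicator_of_mem]
    exact ⟨ht.1, ht.2.trans_lt hc.2⟩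
  have haint : ∀ c ∈ Ico (0:ℝ) 1, IntervalIntegrable a volume 0 c := by
    intro c hc
    have h1 : IntegrableOn (fun t => max (-(deriv l t)) 0) (Ioc 0 c) :=
      ((intervalIntegrable_iff_integrableOn_Ioc_of_le hc.1).1
        (hac c hc).intervalIntegrable_deriv).neg.sup (integrable_zero _ _ _)
    exact (intervalIntegrable_iff_integrableOn_Ioc_of_le hc.1).2
      (h1.congr_fun (haeq c hc) measurableSet_Ioc)
  have hgrow : ∀ s ∈ Ico (0:ℝ) 1, ∀ t ∈ Ico (0:ℝ) 1, s ≤ t → l s - (A t - A s) ≤ l t := by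
    intro s hs t ht hst
    have hsub : AbsolutelyContinuousOnInterval l s t := (hac t ht).mono (by
      rw [uIcc_of_le hst, uIcc_of_le ht.1]; exact Icc_subset_Icc_left hs.1)
    have h1 := hsub.integral_deriv_eq_sub
    have h2 : A t - A s = ∫ r in s..t, a r :=
      intervalIntegral.integral_interval_sub_left (haint t ht) (haint s hs)
    have hgint : IntervalIntegrable a volume s t := (haint s hs).symm.trans (haint t ht)
    have h3 : -(∫ r in s..t, a r) ≤ ∫ r in s..t, deriv l r := by
      rw [← intervalIntegral.integral_neg]
      refine intervalIntegral.integral_mono_on_of_le_Ioo hst hgint.neg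
        hsub.intervalIntegrable_deriv fun r hr => ?_
      have : a r = max (-(deriv l r)) 0 := by
        rw [ha, indicator_of_mem]
        exact ⟨hs.1.trans_lt hr.1, hr.2.trans ht.2⟩
      rw [this, neg_le]
      exact le_max_left _ _
    rw [h2]
    linarith
  have hxA : ∀ s ∈ Ico (0:ℝ) 1, ∀ t ∈ Ico (0:ℝ) 1, s ≤ t →
      x s * Real.exp (-(A t)) ≤ x t * Real.exp (-(A s)) := by
    intro s hs t ht hst
    have h := hgrow s hs t ht hst
    rw [← Real.exp_log (hpos s hs), ← Real.exp_log (hpos t ht), ← Real.exp_add, ← Real.exp_add,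
      Real.exp_le_exp]
    simp only [hl] at h
    linarith
  have hAcont : ContinuousOn A (Ioo 0 1) := by
    intro t ht
    have hc : (t + 1) / 2 ∈ Ico (0:ℝ) 1 := ⟨by linarith [ht.1], by linarith [ht.2]⟩
    have hcont := intervalIntegral.continuousOn_primitive_interval' (haint _ hc) left_mem_uIcc
    rw [uIcc_of_le hc.1] at hcont
    refine (hcont.continuousAt (Icc_mem_nhds ht.1 ?_)).continuousWithinAt
    linarith [ht.2]
  set E : ℝ → ℝ := (Ioo (0:ℝ) 1).indicator (fun t => Real.exp (-(A t))) with hE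
  have hEm : Measurable E := by
    rw [hE, ← piecewise_eq_indicator]
    exact ContinuousOn.measurable_piecewise (Real.continuous_exp.comp_continuousOn hAcont.neg)
      continuousOn_const measurableSet_Ioo
  set e : ℝ → ℝ := fun t => a t * (x 0 * E t) with he
  have hem : Measurable e := ham.mul (measurable_const.mul hEm)
  have he0 : ∀ t, 0 ≤ e t := fun t =>
    mul_nonneg (ha0 t) (mul_nonneg hx0.le (indicator_nonneg (fun _ _ => (Real.exp_pos _).le) t))
  have hout : ∀ t, t ∉ Ioo (0:ℝ) 1 → e t = 0 := by
    intro t ht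
    simp [he, ha, indicator_of_notMem ht]
  have hA0 : A 0 = 0 := by simp [hA]
  have hprim : ∀ t ∈ Ico (0:ℝ) 1,
      IntegrableOn e (Ioc 0 t) ∧ ∫ r in (0:ℝ)..t, e r = x 0 - x 0 * Real.exp (-(A t)) := by
    intro t ht
    set k : ℝ → ℝ := (Ioc 0 t).indicator a with hk
    have hkint : Integrable k := (integrable_indicator_iff measurableSet_Ioc).2
      ((intervalIntegrable_iff_integrableOn_Ioc_of_le ht.1).1 (haint t ht))
    have hkm : Measurable k := ham.indicator measurableSet_Ioc
    have hk0 : ∀ r, 0 ≤ k r := fun r => indicator_nonneg (fun _ _ => ha0 _) r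
    have hkA : ∀ r ∈ Icc 0 t, ∫ q in (0:ℝ)..r, k q = A r := by
      intro r hr
      refine intervalIntegral.integral_congr_ae (Eventually.of_forall fun q hq => ?_)
      rw [uIoc_of_le hr.1] at hq
      rw [hk, indicator_of_mem]
      exact ⟨hq.1, hq.2.trans hr.2⟩
    have hke : EqOn (fun r => k r * (x 0 * Real.exp (-(∫ q in (0:ℝ)..r, k q)))) e (Ioc 0 t) := by
      intro r hr
      simp only [he]
      rw [hkA r ⟨hr.1.le, hr.2⟩, hk, indicator_of_mem hr, hE,
        indicator_of_mem (show r ∈ Ioo (0:ℝ) 1 from ⟨hr.1, hr.2.trans_lt ht.2⟩)]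
    have hcv := integral_comp_primitive hkint hkm hk0 t ht.1
      (g := fun s => x 0 * Real.exp (-s)) (by fun_prop)
    rw [hkA t ⟨ht.1, le_rfl⟩] at hcv
    constructor
    · refine IntegrableOn.congr_fun ?_ hke measurableSet_Ioc
      have hcont : Continuous (fun r => ∫ q in (0:ℝ)..r, k q) :=
        intervalIntegral.continuous_primitive (fun a b => hkint.intervalIntegrable) 0
      have := (hkint.intervalIntegrable (a := 0) (b := t)).mul_continuousOn
        (g := fun r => x 0 * Real.exp (-(∫ q in (0:ℝ)..r, k q))) (by fun_prop)
      exact (intervalIntegrable_iff_integrableOn_Ioc_of_le ht.1).1 this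
    · rw [← intervalIntegral.integral_congr_ae (Eventually.of_forall fun r hr => hke (by
        rwa [uIoc_of_le ht.1] at hr)), hcv, intervalIntegral.integral_const_mul,
        intervalIntegral.integral_comp_neg (fun s => Real.exp s), integral_exp]
      simp
      ring
  have hei : Integrable e := by
    have h1 : IntegrableOn e (Ioc 0 1) := by
      refine integrableOn_Ioc_of_intervalIntegral_norm_bounded_right (I := x 0)
        (l := atTop) (b := fun m : ℕ => 1 - 1 / ((m:ℝ) + 1)) (fun m => ?_) ?_ ?_
      · refine (hprim _ ⟨?_, ?_⟩).1
        · rw [sub_nonneg, div_le_one (by positivity)]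
          linarith [Nat.cast_nonneg (α := ℝ) m]
        · have : (0:ℝ) < 1 / (m + 1) := by positivity
          linarith
      · have := (tendsto_const_nhds (x := (1:ℝ))).sub
          (tendsto_one_div_add_atTop_nhds_zero_nat (𝕜 := ℝ))
        simpa using this
      · refine Eventually.of_forall fun m => ?_
        have h0 : (0:ℝ) ≤ 1 - 1 / (m + 1) := by
          rw [sub_nonneg, div_le_one (by positivity)]
          linarith [Nat.cast_nonneg (α := ℝ) m]
        simp only [Real.norm_of_nonneg (he0 _)]
        rw [← intervalIntegral.integral_of_le h0, (hprim _ ⟨h0, ?_⟩).2]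
        · have := Real.exp_pos (-(A (1 - 1 / ((m:ℝ) + 1))))
          nlinarith
        · have : (0:ℝ) < 1 / (m + 1) := by positivity
          linarith
    refine h1.integrable_of_forall_notMem_eq_zero fun t ht => hout t fun h => ht ⟨h.1, h.2.le⟩
  have hξ : ∀ t ∈ Ico (0:ℝ) 1, x 0 - ∫ r in (0:ℝ)..t, e r = x 0 * Real.exp (-(A t)) := by
    intro t ht
    rw [(hprim t ht).2]
    ring
  have hmin : ∀ t ∈ Ico (0:ℝ) 1, x 0 * Real.exp (-(A t)) ≤ x t := by
    intro t ht
    simpa [hA0] using hxA 0 (by simp) t ht ht.1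
  refine ⟨e, hem, he0, hout, ?_, hei, ?_, ?_, ?_⟩
  · intro t ht
    have hev : ∀ᶠ s in 𝓝 t, 0 < x s := by
      filter_upwards [Ioo_mem_nhds ht.1 ht.2] with s hs using hpos s ⟨hs.1.le, hs.2⟩
    refine le_trans ?_ (abs_deriv_log_le hev)
    have h1 : a t ≤ |deriv l t| := by
      rw [ha, indicator_of_mem ht]
      exact max_le (neg_le_abs _) (abs_nonneg _)
    have h2 : x 0 * E t ≤ x t := by
      rw [hE, indicator_of_mem ht]
      exact hmin t ⟨ht.1.le, ht.2⟩
    exact mul_le_mul h1 h2 (mul_nonneg hx0.le (indicator_nonneg (fun _ _ => (Real.exp_pos _).le) t))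
      (abs_nonneg _)
  · intro t ht
    rw [hξ t ht]
    positivity
  · intro t ht
    rw [hξ t ht]
    exact hmin t ht
  · intro s hs t ht hst
    simp only
    rw [hξ t ht, hξ s hs, div_le_div_iff₀ (hpos t ht) (hpos s hs)]
    have := mul_le_mul_of_nonneg_left (hxA s hs t ht hst) hx0.le
    nlinarith

/-- Euclidean speed computed with two-sided derivatives. -/
def speed (γ : ℝ → ℝ × ℝ) (t : ℝ) : ℝ :=
  Real.sqrt (deriv (fun u => (γ u).1) t ^ 2 + deriv (fun u => (γ u).2) t ^ 2)

theorem measurable_speed (γ : ℝ → ℝ × ℝ) : Measurable (speed γ) :=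
  (((measurable_deriv _).pow_const 2).add ((measurable_deriv _).pow_const 2)).sqrt

theorem speed_nonneg (γ : ℝ → ℝ × ℝ) (t : ℝ) : 0 ≤ speed γ t := Real.sqrt_nonneg _

theorem hSpeedOn_Ico_eq (n : ℕ) (cn : ℝ) (γ : ℝ → ℝ × ℝ) {t : ℝ} (ht : t ∈ Ioo (0:ℝ) 1) :
    hSpeedOn n cn (Ico 0 1) γ t = Fvol n cn (γ t) * speed γ t := by
  have h : Ico (0:ℝ) 1 ∈ 𝓝 t := Ico_mem_nhds ht.1 ht.2
  rw [hSpeedOn, gSpeedOn, derivWithin_of_mem_nhds h, derivWithin_of_mem_nhds h, speed]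

theorem Fvol_pos {n : ℕ} {cn : ℝ} (hcn : 0 < cn) {z : ℝ × ℝ} (hz : z ∈ Pint) : 0 < Fvol n cn z :=
  mul_pos (mul_pos hcn (pow_pos hz.1 _)) (pow_pos hz.2 _)

theorem continuous_Fvol (n : ℕ) (cn : ℝ) : Continuous (Fvol n cn) := by
  unfold Fvol
  fun_prop

theorem MemRh.continuousOn {n : ℕ} {cn x0 y0 : ℝ} {γ : ℝ → ℝ × ℝ} (h : MemRh n cn x0 y0 γ) :
    ContinuousOn γ (Ioo 0 1) := by
  intro t ht
  have hc : (t + 1) / 2 ∈ Ico (0:ℝ) 1 := ⟨by linarith [ht.1], by linarith [ht.2]⟩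
  obtain ⟨K, hK⟩ := h.2.2.1 _ hc
  refine (hK.continuousOn.continuousAt (Icc_mem_nhds ht.1 ?_)).continuousWithinAt
  linarith [ht.2]

theorem MemRh.aemeasurable_Fvol {n : ℕ} {cn x0 y0 : ℝ} {γ : ℝ → ℝ × ℝ} (h : MemRh n cn x0 y0 γ) :
    AEMeasurable (fun t => Fvol n cn (γ t)) (volume.restrict (Ioo 0 1)) :=
  ((continuous_Fvol n cn).comp_continuousOn h.continuousOn).aemeasurable measurableSet_Ioo

theorem MemRh.exists_speed_le {n : ℕ} {cn x0 y0 : ℝ} {γ : ℝ → ℝ × ℝ} (h : MemRh n cn x0 y0 γ)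
    {a : ℝ} (ha : a ∈ Ioo (0:ℝ) 1) : ∃ S, 0 ≤ S ∧ ∀ t ∈ Ioo (0:ℝ) a, speed γ t ≤ S := by
  obtain ⟨K, hK⟩ := h.2.2.1 a ⟨ha.1.le, ha.2⟩
  refine ⟨2 * K, by positivity, fun t ht => ?_⟩
  have hn : Icc (0:ℝ) a ∈ 𝓝 t := Icc_mem_nhds ht.1 ht.2
  have hx : |deriv (fun u => (γ u).1) t| ≤ K :=
    norm_deriv_le_of_lipschitzOn (f := fun u => (γ u).1) hn (by
      have := LipschitzWith.prod_fst.comp_lipschitzOnWith hK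
      rw [one_mul] at this
      exact this)
  have hy : |deriv (fun u => (γ u).2) t| ≤ K :=
    norm_deriv_le_of_lipschitzOn (f := fun u => (γ u).2) hn (by
      have := LipschitzWith.prod_snd.comp_lipschitzOnWith hK
      rw [one_mul] at this
      exact this)
  have hx2 := sq_le_sq' (abs_le.1 hx).1 (abs_le.1 hx).2
  have hy2 := sq_le_sq' (abs_le.1 hy).1 (abs_le.1 hy).2
  rw [speed]
  refine Real.sqrt_le_iff.2 ⟨by positivity, ?_⟩
  nlinarith [sq_nonneg (K:ℝ)]

/-- Primitives of bounded measurable functions are Lipschitz. -/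
theorem lipschitzWith_primitive {g : ℝ → ℝ} (hg : Measurable g) {C : NNReal}
    (hC : ∀ t, |g t| ≤ C) : LipschitzWith C (fun t => ∫ r in (0:ℝ)..t, g r) := by
  have hgint : ∀ a b, IntervalIntegrable g volume a b := fun a b =>
    (intervalIntegrable_const (c := (C:ℝ))).mono_fun hg.aestronglyMeasurable
      (Eventually.of_forall fun t => by simpa using hC t)
  refine LipschitzWith.of_dist_le_mul fun s t => ?_
  rw [Real.dist_eq, intervalIntegral.integral_interval_sub_left (hgint _ _) (hgint _ _),
    Real.dist_eq]
  exact intervalIntegral.norm_integral_le_of_norm_le_const (f := g) (fun r _ => hC r)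

theorem ae_derivWithin_primitive {g : ℝ → ℝ} (hg : Measurable g) {C : NNReal}
    (hC : ∀ t, |g t| ≤ C) :
    ∀ᵐ t, t ∈ Ioo (0:ℝ) 1 → derivWithin (fun t => ∫ r in (0:ℝ)..t, g r) (Icc 0 1) t = g t := by
  have hgint : IntervalIntegrable g volume 0 1 :=
    (intervalIntegrable_const (c := (C:ℝ))).mono_fun hg.aestronglyMeasurable
      (Eventually.of_forall fun t => by simpa using hC t)
  filter_upwards [hgint.ae_hasDerivAt_integral] with t ht htm
  rw [uIcc_of_le zero_le_one] at ht
  rw [derivWithin_of_mem_nhds (Icc_mem_nhds htm.1 htm.2)]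
  exact (ht ⟨htm.1.le, htm.2.le⟩ 0 (by simp)).deriv

theorem lambdaH_nonneg {n : ℕ} {cn p : ℝ} (hcn : 0 < cn) {γ : ℝ → ℝ × ℝ}
    (hγ : ∀ t ∈ Ico (0:ℝ) 1, γ t ∈ Pint) : 0 ≤ lambdaH n cn p γ ∧
    BddBelow {q | ∃ w : ℝ → ℝ, (∃ K, LipschitzOnWith K w (Icc 0 1)) ∧ w 0 = 0 ∧
      IntervalIntegrable (numH n cn p 0 1 (Ico 0 1) γ w) volume 0 1 ∧
      IntervalIntegrable (denH n cn p (Ico 0 1) γ w) volume 0 1 ∧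
      (0 < ∫ t in (0:ℝ)..1, denH n cn p (Ico 0 1) γ w t) ∧
      q = (∫ t in (0:ℝ)..1, numH n cn p 0 1 (Ico 0 1) γ w t) /
        (∫ t in (0:ℝ)..1, denH n cn p (Ico 0 1) γ w t)} := by
  have key : ∀ q ∈ {q | ∃ w : ℝ → ℝ, (∃ K, LipschitzOnWith K w (Icc 0 1)) ∧ w 0 = 0 ∧
      IntervalIntegrable (numH n cn p 0 1 (Ico 0 1) γ w) volume 0 1 ∧
      IntervalIntegrable (denH n cn p (Ico 0 1) γ w) volume 0 1 ∧
      (0 < ∫ t in (0:ℝ)..1, denH n cn p (Ico 0 1) γ w t) ∧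
      q = (∫ t in (0:ℝ)..1, numH n cn p 0 1 (Ico 0 1) γ w t) /
        (∫ t in (0:ℝ)..1, denH n cn p (Ico 0 1) γ w t)}, 0 ≤ q := by
    rintro q ⟨w, -, -, -, -, hD, rfl⟩
    refine div_nonneg ?_ hD.le
    rw [intervalIntegral.integral_of_le zero_le_one, integral_Ioc_eq_integral_Ioo]
    refine setIntegral_nonneg measurableSet_Ioo fun t ht => ?_
    have hF := Fvol_pos (n := n) hcn (hγ t ⟨ht.1.le, ht.2⟩)
    rw [numH, hSpeedOn_Ico_eq _ _ _ ht]
    have := speed_nonneg γ t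
    positivity
  exact ⟨Real.sInf_nonneg key, ⟨0, key⟩⟩

theorem intervalIntegrable_of_bound {φ : ℝ → ℝ} {C : ℝ}
    (hm : AEStronglyMeasurable φ (volume.restrict (Ioo 0 1)))
    (hC : ∀ᵐ t, t ∈ Ioo (0:ℝ) 1 → |φ t| ≤ C) : IntervalIntegrable φ volume 0 1 := by
  rw [intervalIntegrable_iff_integrableOn_Ioc_of_le zero_le_one,
    integrableOn_Ioc_iff_integrableOn_Ioo]
  refine Integrable.mono' (integrable_const C) hm ?_
  rw [ae_restrict_iff' measurableSet_Ioo]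
  filter_upwards [hC] with t ht htm using by simpa using ht htm

/-- The eigenvalue inequality tested with the primitive of `g`, where `g` is dominated by the speed
and supported away from the terminal time. -/
theorem MemRh.lambdaH_mul_lintegral_le {n : ℕ} {cn x0 y0 p : ℝ} (hcn : 0 < cn) (hp : 1 < p)
    {γ : ℝ → ℝ × ℝ} (h : MemRh n cn x0 y0 γ) {a C : ℝ} (ha : a ∈ Ioo (0:ℝ) 1) {g : ℝ → ℝ}
    (hg : Measurable g) (hC0 : 0 ≤ C) (hgC : ∀ t ∈ Ioo 0 a, |g t| ≤ C * speed γ t)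
    (hg0 : ∀ t, t ∉ Ioo 0 a → g t = 0) :
    ENNReal.ofReal (lambdaH n cn p γ) * ∫⁻ t in Ioo 0 a,
        ENNReal.ofReal (|∫ r in (0:ℝ)..t, g r| ^ p * (Fvol n cn (γ t) * speed γ t))
      ≤ ∫⁻ t in Ioo 0 a,
        ENNReal.ofReal (|g t| ^ p * (Fvol n cn (γ t) * speed γ t ^ (1 - p))) := by
  obtain ⟨S, hS0, hS⟩ := h.exists_speed_le ha
  obtain ⟨M, hM⟩ := h.2.2.2.1
  have hFpos : ∀ t ∈ Ioo (0:ℝ) 1, 0 < Fvol n cn (γ t) := fun t ht =>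
    Fvol_pos hcn (h.2.1 t ⟨ht.1.le, ht.2⟩)
  set w : ℝ → ℝ := fun t => ∫ r in (0:ℝ)..t, g r with hw
  have hgB : ∀ t, |g t| ≤ ((C * S).toNNReal : NNReal) := by
    intro t
    rw [Real.coe_toNNReal _ (mul_nonneg hC0 hS0)]
    by_cases ht : t ∈ Ioo 0 a
    · exact (hgC t ht).trans (mul_le_mul_of_nonneg_left (hS t ht) hC0)
    · rw [hg0 t ht, abs_zero]
      positivity
  have hwl := lipschitzWith_primitive hg hgB
  have hwb : ∀ t ∈ Ioo (0:ℝ) 1, |w t| ≤ C * S := by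
    intro t ht
    have := hwl.dist_le_mul t 0
    simp only [intervalIntegral.integral_same, dist_zero_right, Real.norm_eq_abs,
      abs_of_pos ht.1, Real.coe_toNNReal _ (mul_nonneg hC0 hS0)] at this
    exact this.trans (mul_le_of_le_one_right (mul_nonneg hC0 hS0) ht.2.le)
  set N : ℝ → ℝ := fun t => |g t| ^ p * (Fvol n cn (γ t) * speed γ t ^ (1 - p)) with hN
  set D : ℝ → ℝ := fun t => |w t| ^ p * (Fvol n cn (γ t) * speed γ t) with hD
  have hNm : AEMeasurable N (volume.restrict (Ioo 0 1)) :=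
    (hg.abs.pow_const p).aemeasurable.mul
      (h.aemeasurable_Fvol.mul ((measurable_speed γ).pow_const _).aemeasurable)
  have hDm : AEMeasurable D (volume.restrict (Ioo 0 1)) :=
    (hwl.continuous.measurable.abs.pow_const p).aemeasurable.mul
      (h.aemeasurable_Fvol.mul (measurable_speed γ).aemeasurable)
  have hspeedM : ∀ᵐ t, t ∈ Ioo (0:ℝ) 1 → Fvol n cn (γ t) * speed γ t ≤ M := by
    filter_upwards [hM] with t ht htm
    rw [← hSpeedOn_Ico_eq _ _ _ htm]
    exact ht ⟨htm.1.le, htm.2⟩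
  have hN0 : ∀ t ∈ Ioo (0:ℝ) 1, 0 ≤ N t := fun t ht => by
    have := hFpos t ht
    have := speed_nonneg γ t
    positivity
  have hD0 : ∀ t ∈ Ioo (0:ℝ) 1, 0 ≤ D t := fun t ht => by
    have := hFpos t ht
    have := speed_nonneg γ t
    positivity
  have hNint : IntervalIntegrable N volume 0 1 := by
    refine intervalIntegrable_of_bound (C := C ^ p * M) hNm.aestronglyMeasurable ?_
    filter_upwards [hspeedM] with t ht htm
    have hM0 : 0 ≤ M := (mul_nonneg (hFpos t htm).le (speed_nonneg γ t)).trans (ht htm)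
    rw [abs_of_nonneg (hN0 t htm)]
    by_cases hta : t ∈ Ioo 0 a
    · rcases (speed_nonneg γ t).eq_or_lt with hs | hs
      · have : g t = 0 := by simpa [← hs] using hgC t hta
        simp only [hN, this, abs_zero, Real.zero_rpow (by linarith : p ≠ 0), zero_mul]
        positivity
      · calc N t ≤ (C * speed γ t) ^ p * (Fvol n cn (γ t) * speed γ t ^ (1 - p)) := by
              have := hFpos t htm
              exact mul_le_mul_of_nonneg_right (Real.rpow_le_rpow (abs_nonneg _) (hgC t hta)
                (by linarith)) (by positivity)
          _ = C ^ p * (Fvol n cn (γ t) * (speed γ t ^ p * speed γ t ^ (1 - p))) := by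
              rw [Real.mul_rpow hC0 hs.le]; ring
          _ = C ^ p * (Fvol n cn (γ t) * speed γ t) := by
              rw [← Real.rpow_add hs]; simp
          _ ≤ C ^ p * M := by
              exact mul_le_mul_of_nonneg_left (ht htm) (by positivity)
    · simp only [hN, hg0 t hta, abs_zero, Real.zero_rpow (by linarith : p ≠ 0), zero_mul]
      positivity
  have hDint : IntervalIntegrable D volume 0 1 := by
    refine intervalIntegrable_of_bound (C := (C * S) ^ p * M) hDm.aestronglyMeasurable ?_
    filter_upwards [hspeedM] with t ht htm
    rw [abs_of_nonneg (hD0 t htm)]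
    have hM0 := mul_nonneg (hFpos t htm).le (speed_nonneg γ t)
    exact mul_le_mul (Real.rpow_le_rpow (abs_nonneg _) (hwb t htm) (by linarith)) (ht htm) hM0
      (by positivity)
  have hnum : N =ᵐ[volume.restrict (uIoc 0 1)] numH n cn p 0 1 (Ico 0 1) γ w := by
    rw [uIoc_of_le zero_le_one, ← restrict_Ioo_eq_restrict_Ioc]
    filter_upwards [ae_restrict_mem measurableSet_Ioo,
      ae_restrict_of_ae (ae_derivWithin_primitive hg hgB)] with t htm ht
    rw [numH, ht htm, hSpeedOn_Ico_eq _ _ _ htm,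
      Real.mul_rpow (hFpos t htm).le (speed_nonneg γ t)]
    have : Fvol n cn (γ t) = Fvol n cn (γ t) ^ p * Fvol n cn (γ t) ^ (1 - p) := by
      rw [← Real.rpow_add (hFpos t htm)]; simp
    simp only [hN]
    nth_rewrite 1 [this]
    ring
  have hden : D =ᵐ[volume.restrict (uIoc 0 1)] denH n cn p (Ico 0 1) γ w := by
    rw [uIoc_of_le zero_le_one, ← restrict_Ioo_eq_restrict_Ioc]
    filter_upwards [ae_restrict_mem measurableSet_Ioo] with t htm
    rw [denH, hSpeedOn_Ico_eq _ _ _ htm]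
  have hgint : lambdaH n cn p γ * (∫ t in (0:ℝ)..1, D t) ≤ ∫ t in (0:ℝ)..1, N t := by
    have hNi : 0 ≤ ∫ t in (0:ℝ)..1, N t := by
      rw [intervalIntegral.integral_of_le zero_le_one, integral_Ioc_eq_integral_Ioo]
      exact setIntegral_nonneg measurableSet_Ioo hN0
    rcases le_or_gt (∫ t in (0:ℝ)..1, D t) 0 with hle | hlt
    · exact (mul_nonpos_of_nonneg_of_nonpos (lambdaH_nonneg hcn h.2.1).1 hle).trans hNi
    · rw [← le_div_iff₀ hlt]
      have e1 : ∫ t in (0:ℝ)..1, N t = ∫ t in (0:ℝ)..1, numH n cn p 0 1 (Ico 0 1) γ w t :=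
        intervalIntegral.integral_congr_ae_restrict hnum
      have e2 : ∫ t in (0:ℝ)..1, D t = ∫ t in (0:ℝ)..1, denH n cn p (Ico 0 1) γ w t :=
        intervalIntegral.integral_congr_ae_restrict hden
      refine csInf_le (lambdaH_nonneg hcn h.2.1).2 ⟨w, ⟨_, hwl.lipschitzOnWith⟩, by simp [hw],
        hNint.congr_ae hnum, hDint.congr_ae hden, ?_, ?_⟩
      · rwa [← e2]
      · rw [e1, e2]
  have conv : ∀ φ : ℝ → ℝ, IntervalIntegrable φ volume 0 1 → (∀ t ∈ Ioo (0:ℝ) 1, 0 ≤ φ t) →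
      ∫⁻ t in Ioo (0:ℝ) 1, ENNReal.ofReal (φ t) = ENNReal.ofReal (∫ t in (0:ℝ)..1, φ t) := by
    intro φ hφ hφ0
    rw [intervalIntegral.integral_of_le zero_le_one, integral_Ioc_eq_integral_Ioo,
      ofReal_integral_eq_lintegral_ofReal]
    · exact (integrableOn_Ioc_iff_integrableOn_Ioo (by simp)).1
        ((intervalIntegrable_iff_integrableOn_Ioc_of_le zero_le_one).1 hφ)
    · exact (ae_restrict_iff' measurableSet_Ioo).2 (Eventually.of_forall hφ0)
  have hsub : Ioo 0 a ⊆ Ioo (0:ℝ) 1 := Ioo_subset_Ioo_right ha.2.le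
  calc _ ≤ ENNReal.ofReal (lambdaH n cn p γ) * ∫⁻ t in Ioo (0:ℝ) 1, ENNReal.ofReal (D t) := by
        gcongr
    _ = ENNReal.ofReal (lambdaH n cn p γ * (∫ t in (0:ℝ)..1, D t)) := by
        rw [conv D hDint hD0, ENNReal.ofReal_mul (lambdaH_nonneg hcn h.2.1).1]
    _ ≤ ENNReal.ofReal (∫ t in (0:ℝ)..1, N t) := ENNReal.ofReal_le_ofReal hgint
    _ = ∫⁻ t in Ioo (0:ℝ) 1, ENNReal.ofReal (N t) := (conv N hNint hN0).symm
    _ = ∫⁻ t in Ioo 0 a, ENNReal.ofReal (N t) := by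
        rw [← inter_eq_left.2 hsub, ← setLIntegral_indicator measurableSet_Ioo]
        refine setLIntegral_congr_fun measurableSet_Ioo fun t _ => ?_
        by_cases hta : t ∈ Ioo 0 a
        · rw [indicator_of_mem hta]
        · rw [indicator_of_notMem hta]
          simp [hN, hg0 t hta, Real.zero_rpow (by linarith : p ≠ 0)]

theorem sq_integral_add_sq_integral_le {e e' : ℝ → ℝ} {a b : ℝ} (hab : a ≤ b)
    (he : IntervalIntegrable e volume a b) (he' : IntervalIntegrable e' volume a b)
    (hj : IntervalIntegrable (fun t => Real.sqrt (e t ^ 2 + e' t ^ 2)) volume a b) :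
    (∫ t in a..b, e t) ^ 2 + (∫ t in a..b, e' t) ^ 2
      ≤ (∫ t in a..b, Real.sqrt (e t ^ 2 + e' t ^ 2)) ^ 2 := by
  set A := ∫ t in a..b, e t
  set B := ∫ t in a..b, e' t
  set J := ∫ t in a..b, Real.sqrt (e t ^ 2 + e' t ^ 2)
  set R := Real.sqrt (A ^ 2 + B ^ 2) with hR
  have hR2 : R ^ 2 = A ^ 2 + B ^ 2 := Real.sq_sqrt (by positivity)
  have hJ0 : 0 ≤ J := intervalIntegral.integral_nonneg hab fun t _ => Real.sqrt_nonneg _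
  have h : A * A + B * B ≤ R * J := by
    have h1 : A * A + B * B = ∫ t in a..b, (A * e t + B * e' t) := by
      rw [intervalIntegral.integral_add (he.const_mul A) (he'.const_mul B),
        intervalIntegral.integral_const_mul, intervalIntegral.integral_const_mul]
    rw [h1, ← intervalIntegral.integral_const_mul]
    refine intervalIntegral.integral_mono_on hab ((he.const_mul A).add (he'.const_mul B))
      (hj.const_mul R) fun t _ => ?_
    rw [hR, ← Real.sqrt_mul (by positivity)]
    exact Real.le_sqrt_of_sq_le (by nlinarith [sq_nonneg (A * e' t - B * e t)])
  have hRJ : R ≤ J := by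
    rcases (Real.sqrt_nonneg (A ^ 2 + B ^ 2)).eq_or_lt with h0 | h0
    · rw [hR, ← h0]
      exact hJ0
    · exact le_of_mul_le_mul_left (by nlinarith) h0
  rw [← hR2]
  exact pow_le_pow_left₀ (Real.sqrt_nonneg _) hRJ 2

/-- A pair of nonincreasing functions with derivatives `-e`, `-e'` can be reparametrized on `[0,1]`
proportionally to arclength. -/
theorem exists_arclength_reparametrization {e e' : ℝ → ℝ} (he0 : ∀ t, 0 ≤ e t)
    (he0' : ∀ t, 0 ≤ e' t) (he : Integrable e) (he' : Integrable e')
    (hj : Integrable (fun t => Real.sqrt (e t ^ 2 + e' t ^ 2))) {L : ℝ}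
    (hL : L = ∫ t in (0:ℝ)..1, Real.sqrt (e t ^ 2 + e' t ^ 2)) (hLpos : 0 < L) (x0 y0 : ℝ) :
    ∃ X Y : ℝ → ℝ, Continuous X ∧ Continuous Y ∧
      (∀ t ∈ Icc (0:ℝ) 1, X (∫ r in (0:ℝ)..t, Real.sqrt (e r ^ 2 + e' r ^ 2) / L)
        = x0 - ∫ r in (0:ℝ)..t, e r) ∧
      (∀ t ∈ Icc (0:ℝ) 1, Y (∫ r in (0:ℝ)..t, Real.sqrt (e r ^ 2 + e' r ^ 2) / L)
        = y0 - ∫ r in (0:ℝ)..t, e' r) ∧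
      (∀ τ ∈ Icc (0:ℝ) 1, ∃ t ∈ Icc (0:ℝ) 1,
        τ = ∫ r in (0:ℝ)..t, Real.sqrt (e r ^ 2 + e' r ^ 2) / L) ∧
      ∀ s ∈ Icc (0:ℝ) 1, ∀ t ∈ Icc (0:ℝ) 1, s ≤ t → X t ≤ X s ∧ Y t ≤ Y s ∧
        (X s - X t) ^ 2 + (Y s - Y t) ^ 2 ≤ (L * (t - s)) ^ 2 ∧
        L * (t - s) ≤ X s - X t + (Y s - Y t) := by
  set j : ℝ → ℝ := fun t => Real.sqrt (e t ^ 2 + e' t ^ 2) with hjdef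
  set E : ℝ → ℝ := fun t => ∫ r in (0:ℝ)..t, e r with hE
  set E' : ℝ → ℝ := fun t => ∫ r in (0:ℝ)..t, e' r with hE'
  set J : ℝ → ℝ := fun t => ∫ r in (0:ℝ)..t, j r with hJ
  have hj0 : ∀ t, 0 ≤ j t := fun t => Real.sqrt_nonneg _
  have hsub : ∀ {q : ℝ → ℝ}, Integrable q → ∀ a b, (∫ r in (0:ℝ)..b, q r) - ∫ r in (0:ℝ)..a, q r
      = ∫ r in a..b, q r := fun hq a b =>
    intervalIntegral.integral_interval_sub_left hq.intervalIntegrable hq.intervalIntegrable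
  have hmono : ∀ a b, a ≤ b → 0 ≤ E b - E a ∧ 0 ≤ E' b - E' a ∧
      (E b - E a) ^ 2 + (E' b - E' a) ^ 2 ≤ (J b - J a) ^ 2 ∧
      J b - J a ≤ (E b - E a) + (E' b - E' a) ∧ 0 ≤ J b - J a := by
    intro a b hab
    simp only [hE, hE', hJ, hsub he, hsub he', hsub hj]
    refine ⟨intervalIntegral.integral_nonneg hab fun t _ => he0 t,
      intervalIntegral.integral_nonneg hab fun t _ => he0' t,
      sq_integral_add_sq_integral_le hab he.intervalIntegrable he'.intervalIntegrable
        hj.intervalIntegrable, ?_, intervalIntegral.integral_nonneg hab fun t _ => hj0 t⟩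
    rw [← intervalIntegral.integral_add he.intervalIntegrable he'.intervalIntegrable]
    refine intervalIntegral.integral_mono_on hab hj.intervalIntegrable
      (he.intervalIntegrable.add he'.intervalIntegrable) fun t _ => ?_
    exact Real.sqrt_le_iff.2 ⟨add_nonneg (he0 t) (he0' t),
      by nlinarith [mul_nonneg (he0 t) (he0' t)]⟩
  have key : ∀ a b, J a ≤ J b → 0 ≤ E b - E a ∧ 0 ≤ E' b - E' a ∧
      (E b - E a) ^ 2 + (E' b - E' a) ^ 2 ≤ (J b - J a) ^ 2 ∧
      J b - J a ≤ (E b - E a) + (E' b - E' a) := by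
    intro a b hab
    rcases le_total a b with h | h
    · obtain ⟨h1, h2, h3, h4, -⟩ := hmono a b h
      exact ⟨h1, h2, h3, h4⟩
    · obtain ⟨h1, h2, h3, h4, h5⟩ := hmono b a h
      have hJeq : J a - J b = 0 := by linarith
      rw [hJeq] at h3
      have z1 : E a - E b = 0 := by nlinarith [sq_nonneg (E a - E b), sq_nonneg (E' a - E' b)]
      have z2 : E' a - E' b = 0 := by nlinarith [sq_nonneg (E a - E b), sq_nonneg (E' a - E' b)]
      refine ⟨by linarith, by linarith, ?_, by linarith⟩
      rw [show E b - E a = 0 by linarith, show E' b - E' a = 0 by linarith]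
      simpa using sq_nonneg (J b - J a)
  have hJc : Continuous J :=
    intervalIntegral.continuous_primitive (fun a b => hj.intervalIntegrable) 0
  have hdiv : ∀ t, ∫ r in (0:ℝ)..t, j r / L = J t / L := fun t =>
    intervalIntegral.integral_div L j
  have hJ0 : J 0 = 0 := intervalIntegral.integral_same
  have hJ1 : J 1 = L := hL.symm
  have hT : ∀ τ : ℝ, ∃ t ∈ Icc (0:ℝ) 1, J t = L * (projIcc (0:ℝ) 1 zero_le_one τ : ℝ) := by
    intro τ
    have hτ := (projIcc (0:ℝ) 1 zero_le_one τ).2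
    have := intermediate_value_Icc (zero_le_one' ℝ) hJc.continuousOn
    rw [hJ0, hJ1] at this
    exact this ⟨mul_nonneg hLpos.le hτ.1, mul_le_of_le_one_right hLpos.le hτ.2⟩
  choose T hTm hTJ using hT
  have hval : ∀ t ∈ Icc (0:ℝ) 1, J (T (J t / L)) = J t := by
    intro t ht
    have h1 := (hmono 0 t ht.1).2.2.2.2
    have h2 := (hmono t 1 ht.2).2.2.2.2
    rw [hTJ, projIcc_of_mem zero_le_one (⟨div_nonneg (by linarith) hLpos.le,
      (div_le_one hLpos).2 (by linarith)⟩ : J t / L ∈ Icc (0:ℝ) 1)]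
    simp only
    field_simp
  have hTproj : ∀ s ∈ Icc (0:ℝ) 1, J (T s) = L * s := fun s hs => by
    rw [hTJ, projIcc_of_mem zero_le_one hs]
  have hlip : ∀ s t, |E (T s) - E (T t)| ≤ L * |s - t| ∧ |E' (T s) - E' (T t)| ≤ L * |s - t| := by
    have main : ∀ s t, s ≤ t → |E (T s) - E (T t)| ≤ L * |s - t| ∧
        |E' (T s) - E' (T t)| ≤ L * |s - t| := by
      intro s t hst
      have hp := monotone_projIcc (zero_le_one' ℝ) hst
      have hp' : (projIcc (0:ℝ) 1 zero_le_one s : ℝ) ≤ projIcc (0:ℝ) 1 zero_le_one t := hp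
      have hd : (projIcc (0:ℝ) 1 zero_le_one t : ℝ) - projIcc (0:ℝ) 1 zero_le_one s ≤ t - s := by
        rw [coe_projIcc, coe_projIcc]
        rcases max_cases 0 (min 1 t) with h | h <;> rcases max_cases 0 (min 1 s) with h' | h' <;>
        rcases min_cases 1 t with h'' | h'' <;> rcases min_cases 1 s with h''' | h''' <;> linarith
      obtain ⟨h1, h2, h3, h4⟩ := key (T s) (T t) (by
        rw [hTJ, hTJ]; exact mul_le_mul_of_nonneg_left hp' hLpos.le)
      have hJd : 0 ≤ J (T t) - J (T s) ∧ J (T t) - J (T s) ≤ L * (t - s) := by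
        rw [hTJ, hTJ]
        exact ⟨by nlinarith, by nlinarith⟩
      rw [abs_sub_comm s t, abs_of_nonneg (sub_nonneg.2 hst), abs_sub_comm, abs_of_nonneg h1,
        abs_sub_comm, abs_of_nonneg h2]
      exact ⟨(abs_le_of_sq_le_sq' (by nlinarith [sq_nonneg (E' (T t) - E' (T s))]) hJd.1).2.trans
        hJd.2, (abs_le_of_sq_le_sq' (by nlinarith [sq_nonneg (E (T t) - E (T s))]) hJd.1).2.trans
        hJd.2⟩
    intro s t
    rcases le_total s t with h | h
    · exact main s t h
    · rw [abs_sub_comm, abs_sub_comm (E' (T s)), abs_sub_comm s]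
      exact main t s h
  have hcont : ∀ (c : ℝ) {q : ℝ → ℝ}, (∀ s t, |q s - q t| ≤ L * |s - t|) →
      Continuous (fun τ => c - q τ) := fun c q hq =>
    continuous_const.sub (LipschitzWith.of_dist_le_mul (K := ⟨L, hLpos.le⟩) hq).continuous
  refine ⟨fun τ => x0 - E (T τ), fun τ => y0 - E' (T τ), hcont x0 fun s t => (hlip s t).1,
    hcont y0 fun s t => (hlip s t).2, ?_, ?_, ?_, ?_⟩
  · intro t ht
    change x0 - E (T (∫ r in (0:ℝ)..t, j r / L)) = x0 - E t
    rw [hdiv]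
    have h1 := (key (T (J t / L)) t (hval t ht).le).1
    have h2 := (key t (T (J t / L)) (hval t ht).ge).1
    linarith
  · intro t ht
    change y0 - E' (T (∫ r in (0:ℝ)..t, j r / L)) = y0 - E' t
    rw [hdiv]
    have h1 := (key (T (J t / L)) t (hval t ht).le).2.1
    have h2 := (key t (T (J t / L)) (hval t ht).ge).2.1
    linarith
  · intro τ hτ
    refine ⟨T τ, hTm τ, ?_⟩
    rw [hdiv, hTproj τ hτ]
    field_simp
  · intro s hs t ht hst
    obtain ⟨h1, h2, h3, h4⟩ := key (T s) (T t) (by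
      rw [hTproj s hs, hTproj t ht]; exact mul_le_mul_of_nonneg_left hst hLpos.le)
    rw [hTproj s hs, hTproj t ht] at h3 h4
    refine ⟨by linarith, by linarith, ?_, by linarith⟩
    calc _ = (E (T t) - E (T s)) ^ 2 + (E' (T t) - E' (T s)) ^ 2 := by ring
      _ ≤ (L * t - L * s) ^ 2 := h3
      _ = _ := by ring

/-- A pair of nonincreasing coordinate functions from `(x0, y0)` to the boundary of the quadrant,
Lipschitz with constant `L` and moving with `ℓ¹`-speed at least `L`. -/
structure IsDescent (x0 y0 : ℝ) (X Y : ℝ → ℝ) (L : ℝ) : Prop where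
  start_fst : X 0 = x0
  start_snd : Y 0 = y0
  end_eq : X 1 * Y 1 = 0
  nonneg_fst : ∀ t ∈ Icc (0:ℝ) 1, 0 ≤ X t
  nonneg_snd : ∀ t ∈ Icc (0:ℝ) 1, 0 ≤ Y t
  anti_fst : ∀ s ∈ Icc (0:ℝ) 1, ∀ t ∈ Icc (0:ℝ) 1, s ≤ t → X t ≤ X s
  anti_snd : ∀ s ∈ Icc (0:ℝ) 1, ∀ t ∈ Icc (0:ℝ) 1, s ≤ t → Y t ≤ Y s
  upper : ∀ s ∈ Icc (0:ℝ) 1, ∀ t ∈ Icc (0:ℝ) 1, s ≤ t →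
    (X s - X t) ^ 2 + (Y s - Y t) ^ 2 ≤ (L * (t - s)) ^ 2
  lower : ∀ s ∈ Icc (0:ℝ) 1, ∀ t ∈ Icc (0:ℝ) 1, s ≤ t → L * (t - s) ≤ X s - X t + (Y s - Y t)

/-- The weighted Hardy inequality with constant `l` along a pair of coordinate functions. -/
def HardyIneq (n : ℕ) (p : ℝ) (X Y : ℝ → ℝ) (L l : ℝ) : Prop :=
  ∀ f : ℝ → ℝ, Measurable f → (∃ C, ∀ t, |f t| ≤ C) →
    l * L ^ p * (∫ τ in (0:ℝ)..1, |∫ r in (0:ℝ)..τ, f r| ^ p * (X τ * Y τ) ^ (n - 1))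
      ≤ ∫ τ in (0:ℝ)..1, |f τ| ^ p * (X τ * Y τ) ^ (n - 1)

theorem intervalIntegrable_abs_rpow {f : ℝ → ℝ} {p C : ℝ} (hp : 0 ≤ p) (hf : Measurable f)
    (hC : ∀ t ∈ Ioo (0:ℝ) 1, |f t| ≤ C) : IntervalIntegrable (fun t => |f t| ^ p) volume 0 1 := by
  refine intervalIntegrable_of_bound (C := C ^ p) (hf.abs.pow_const p).aestronglyMeasurable
    (Eventually.of_forall fun t ht => ?_)
  rw [abs_of_nonneg (Real.rpow_nonneg (abs_nonneg _) _)]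
  exact Real.rpow_le_rpow (abs_nonneg _) (hC t ht) hp

theorem setLIntegral_Icc_ofReal_eq {φ : ℝ → ℝ} (hφ : IntervalIntegrable φ volume 0 1)
    (h0 : ∀ t ∈ Icc (0:ℝ) 1, 0 ≤ φ t) :
    ∫⁻ t in Icc (0:ℝ) 1, ENNReal.ofReal (φ t) = ENNReal.ofReal (∫ t in (0:ℝ)..1, φ t) := by
  rw [intervalIntegral.integral_of_le zero_le_one, ← integral_Icc_eq_integral_Ioc,
    ofReal_integral_eq_lintegral_ofReal]
  · exact (intervalIntegrable_iff_integrableOn_Icc_of_le zero_le_one).1 hφ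
  · exact (ae_restrict_iff' measurableSet_Icc).2 (Eventually.of_forall h0)

theorem setLIntegral_Ioo_eq_Icc (φ : ℝ → ENNReal) (a b : ℝ) :
    ∫⁻ t in Ioo a b, φ t = ∫⁻ t in Icc a b, φ t := by
  rw [restrict_Ioo_eq_restrict_Icc]

theorem bounded_primitive {f : ℝ → ℝ} {C : ℝ} (hC : ∀ t, |f t| ≤ C) :
    ∀ t ∈ Icc (0:ℝ) 1, |∫ r in (0:ℝ)..t, f r| ≤ C := by
  intro t ht
  have := intervalIntegral.norm_integral_le_of_norm_le_const (a := 0) (b := t) (f := f)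
    (fun r _ => hC r)
  rw [sub_zero, abs_of_nonneg ht.1] at this
  exact this.trans (mul_le_of_le_one_right ((abs_nonneg _).trans (hC 0)) ht.2)

/-- Every curve in `R_h` is dominated, in the sense of the Hardy inequality, by a descent. -/
theorem MemRh.exists_isDescent {n : ℕ} {cn x0 y0 p : ℝ} (hcn : 0 < cn) (hp : 1 < p)
    (hx0 : 0 < x0) (hy0 : 0 < y0) {γ : ℝ → ℝ × ℝ} (h : MemRh n cn x0 y0 γ) :
    ∃ (X Y : ℝ → ℝ) (L : ℝ), Continuous X ∧ Continuous Y ∧ 0 ≤ L ∧ IsDescent x0 y0 X Y L ∧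
      HardyIneq n p X Y L (lambdaH n cn p γ) := by
  have hlip1 : ∀ a ∈ Ico (0:ℝ) 1, ∃ K, LipschitzOnWith K (fun t => (γ t).1) (Icc 0 a) := by
    intro a ha
    obtain ⟨K, hK⟩ := h.2.2.1 a ha
    exact ⟨_, LipschitzWith.prod_fst.comp_lipschitzOnWith hK⟩
  have hlip2 : ∀ a ∈ Ico (0:ℝ) 1, ∃ K, LipschitzOnWith K (fun t => (γ t).2) (Icc 0 a) := by
    intro a ha
    obtain ⟨K, hK⟩ := h.2.2.1 a ha
    exact ⟨_, LipschitzWith.prod_snd.comp_lipschitzOnWith hK⟩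
  obtain ⟨e, hem, he0, -, hele, hei, hξpos, hξle, hξanti⟩ :=
    exists_nonincreasing_minorant (fun t ht => (h.2.1 t ht).1) hlip1
  obtain ⟨e', hem', he0', -, hele', hei', hηpos, hηle, hηanti⟩ :=
    exists_nonincreasing_minorant (fun t ht => (h.2.1 t ht).2) hlip2
  have hγ1 : (γ 0).1 = x0 := by rw [h.1]
  have hγ2 : (γ 0).2 = y0 := by rw [h.1]
  simp only [hγ1] at hξpos hξle hξanti
  simp only [hγ2] at hηpos hηle hηanti
  set ξ : ℝ → ℝ := fun t => x0 - ∫ r in (0:ℝ)..t, e r with hξ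
  set η : ℝ → ℝ := fun t => y0 - ∫ r in (0:ℝ)..t, e' r with hη
  have hξc : Continuous ξ := continuous_const.sub
    (intervalIntegral.continuous_primitive (fun a b => hei.intervalIntegrable) 0)
  have hηc : Continuous η := continuous_const.sub
    (intervalIntegral.continuous_primitive (fun a b => hei'.intervalIntegrable) 0)
  set j : ℝ → ℝ := fun t => Real.sqrt (e t ^ 2 + e' t ^ 2) with hj
  have hjm : Measurable j := ((hem.pow_const 2).add (hem'.pow_const 2)).sqrt
  have hj0 : ∀ t, 0 ≤ j t := fun t => Real.sqrt_nonneg _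
  have hji : Integrable j := by
    refine (hei.add hei').mono' hjm.aestronglyMeasurable (Eventually.of_forall fun t => ?_)
    rw [Real.norm_eq_abs, abs_of_nonneg (hj0 t)]
    exact Real.sqrt_le_iff.2 ⟨add_nonneg (he0 t) (he0' t),
      by simp only [Pi.add_apply]; nlinarith [mul_nonneg (he0 t) (he0' t)]⟩
  have hjs : ∀ t ∈ Ioo (0:ℝ) 1, j t ≤ speed γ t := by
    intro t ht
    refine Real.sqrt_le_sqrt (add_le_add ?_ ?_)
    · rw [← sq_abs (deriv _ t)]
      exact pow_le_pow_left₀ (he0 t) (hele t ht) 2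
    · rw [← sq_abs (deriv _ t)]
      exact pow_le_pow_left₀ (he0' t) (hele' t ht) 2
  have hIcoIoo : Ico (0:ℝ) 1 ∈ 𝓝[<] (1:ℝ) := Ico_mem_nhdsLT zero_lt_one
  have hξ1 : 0 ≤ ξ 1 := ge_of_tendsto (hξc.continuousAt.tendsto.mono_left nhdsWithin_le_nhds)
    (mem_of_superset hIcoIoo fun t ht => (hξpos t ht).le)
  have hη1 : 0 ≤ η 1 := ge_of_tendsto (hηc.continuousAt.tendsto.mono_left nhdsWithin_le_nhds)
    (mem_of_superset hIcoIoo fun t ht => (hηpos t ht).le)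
  have hend : ξ 1 * η 1 = 0 := by
    refine le_antisymm ?_ (mul_nonneg hξ1 hη1)
    refine le_of_tendsto_of_tendsto
      (((hξc.mul hηc).continuousAt (x := 1)).tendsto.mono_left nhdsWithin_le_nhds) h.2.2.2.2
      (mem_of_superset hIcoIoo fun t ht => ?_)
    exact mul_le_mul (hξle t ht) (hηle t ht) (hηpos t ht).le (h.2.1 t ht).1.le
  set L : ℝ := ∫ t in (0:ℝ)..1, j t with hL
  have hLpos : 0 < L := by
    have h1 : ∫ t in (0:ℝ)..1, e t ≤ L :=
      intervalIntegral.integral_mono_on zero_le_one hei.intervalIntegrable hji.intervalIntegrable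
        fun t _ => Real.le_sqrt_of_sq_le (by nlinarith [sq_nonneg (e' t)])
    have h2 : ∫ t in (0:ℝ)..1, e' t ≤ L :=
      intervalIntegral.integral_mono_on zero_le_one hei'.intervalIntegrable hji.intervalIntegrable
        fun t _ => Real.le_sqrt_of_sq_le (by nlinarith [sq_nonneg (e t)])
    rcases mul_eq_zero.1 hend with h0 | h0 <;> simp only [hξ, hη] at h0 <;> linarith
  obtain ⟨X, Y, hXc, hYc, hX, hY, hsurj, hXY⟩ :=
    exists_arclength_reparametrization he0 he0' hei hei' hji hL hLpos x0 y0
  set k : ℝ → ℝ := fun t => j t / L with hk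
  set σ : ℝ → ℝ := fun t => ∫ r in (0:ℝ)..t, k r with hσ
  have hkm : Measurable k := hjm.div_const L
  have hk0 : ∀ t, 0 ≤ k t := fun t => div_nonneg (hj0 t) hLpos.le
  have hki : Integrable k := hji.div_const L
  have hσ0 : σ 0 = 0 := intervalIntegral.integral_same
  have hσ1 : σ 1 = 1 := by
    simp only [hσ, hk]
    rw [intervalIntegral.integral_div, ← hL, div_self hLpos.ne']
  have hσc : Continuous σ :=
    intervalIntegral.continuous_primitive (fun a b => hki.intervalIntegrable) 0
  have hξ0' : ∀ t ∈ Icc (0:ℝ) 1, 0 ≤ ξ t := fun t ht => by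
    rcases ht.2.eq_or_lt with rfl | h1
    · exact hξ1
    · exact (hξpos t ⟨ht.1, h1⟩).le
  have hη0' : ∀ t ∈ Icc (0:ℝ) 1, 0 ≤ η t := fun t ht => by
    rcases ht.2.eq_or_lt with rfl | h1
    · exact hη1
    · exact (hηpos t ⟨ht.1, h1⟩).le
  have hX0 : ∀ τ ∈ Icc (0:ℝ) 1, 0 ≤ X τ := by
    intro τ hτ
    obtain ⟨t, ht, rfl⟩ := hsurj τ hτ
    rw [hX t ht]
    exact hξ0' t ht
  have hY0 : ∀ τ ∈ Icc (0:ℝ) 1, 0 ≤ Y τ := by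
    intro τ hτ
    obtain ⟨t, ht, rfl⟩ := hsurj τ hτ
    rw [hY t ht]
    exact hη0' t ht
  have hz : (0:ℝ) ∈ Icc (0:ℝ) 1 := ⟨le_rfl, zero_le_one⟩
  have ho : (1:ℝ) ∈ Icc (0:ℝ) 1 := ⟨zero_le_one, le_rfl⟩
  have hXσ : ∀ t ∈ Icc (0:ℝ) 1, X (σ t) = ξ t := hX
  have hYσ : ∀ t ∈ Icc (0:ℝ) 1, Y (σ t) = η t := hY
  refine ⟨X, Y, L, hXc, hYc, hLpos.le, ⟨?_, ?_, ?_, hX0, hY0, ?_, ?_, ?_, ?_⟩, ?_⟩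
  · rw [← hσ0, hXσ 0 hz]; simp [hξ]
  · rw [← hσ0, hYσ 0 hz]; simp [hη]
  · rw [← hσ1, hXσ 1 ho, hYσ 1 ho, hend]
  · exact fun s hs t ht hst => (hXY s hs t ht hst).1
  · exact fun s hs t ht hst => (hXY s hs t ht hst).2.1
  · exact fun s hs t ht hst => (hXY s hs t ht hst).2.2.1
  · exact fun s hs t ht hst => (hXY s hs t ht hst).2.2.2
  rintro f hfm ⟨C, hfC⟩
  have hC0 : 0 ≤ C := (abs_nonneg _).trans (hfC 0)
  have hp0 : 0 < p := by linarith
  set l := lambdaH n cn p γ with hl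
  have hl0 : 0 ≤ l := (lambdaH_nonneg hcn h.2.1).1
  set W : ℝ → ℝ := fun τ => ∫ r in (0:ℝ)..τ, f r with hW
  have hfi : ∀ a b, IntervalIntegrable f volume a b := fun a b =>
    (intervalIntegrable_const (c := C)).mono_fun hfm.aestronglyMeasurable
      (Eventually.of_forall fun t => (hfC t).trans (le_abs_self C))
  have hWc : Continuous W := intervalIntegral.continuous_primitive hfi 0
  have hWσ : Measurable fun t => W (σ t) := (hWc.comp hσc).measurable
  set G₁ : ℝ → ℝ := fun τ => |W τ| ^ p * (X τ * Y τ) ^ (n - 1) with hG₁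
  set G₂ : ℝ → ℝ := fun τ => |f τ| ^ p * (X τ * Y τ) ^ (n - 1) with hG₂
  have hVc : Continuous fun τ => (X τ * Y τ) ^ (n - 1) := (hXc.mul hYc).pow _
  have hG₁i : IntervalIntegrable G₁ volume 0 1 :=
    (intervalIntegrable_abs_rpow hp0.le hWc.measurable fun t ht =>
      bounded_primitive hfC t ⟨ht.1.le, ht.2.le⟩).mul_continuousOn hVc.continuousOn
  have hG₂i : IntervalIntegrable G₂ volume 0 1 :=
    (intervalIntegrable_abs_rpow hp0.le hfm fun t _ => hfC t).mul_continuousOn hVc.continuousOn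
  have hV0 : ∀ τ ∈ Icc (0:ℝ) 1, 0 ≤ (X τ * Y τ) ^ (n - 1) := fun τ hτ =>
    pow_nonneg (mul_nonneg (hX0 τ hτ) (hY0 τ hτ)) _
  have hG₁0 : ∀ τ ∈ Icc (0:ℝ) 1, 0 ≤ G₁ τ := fun τ hτ =>
    mul_nonneg (Real.rpow_nonneg (abs_nonneg _) _) (hV0 τ hτ)
  have hG₂0 : ∀ τ ∈ Icc (0:ℝ) 1, 0 ≤ G₂ τ := fun τ hτ =>
    mul_nonneg (Real.rpow_nonneg (abs_nonneg _) _) (hV0 τ hτ)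
  have hG₁m : Measurable G₁ := (hWc.measurable.abs.pow_const p).mul hVc.measurable
  have hG₂m : Measurable G₂ := (hfm.abs.pow_const p).mul hVc.measurable
  have hstopped_le : ∀ a ∈ Ioo (0:ℝ) 1,
      ∫⁻ t in Ioo 0 a, ENNReal.ofReal l * ENNReal.ofReal
        (|W (σ t)| ^ p * (Fvol n cn (γ t) * j t))
      ≤ ∫⁻ t in Ioo 0 a, ENNReal.ofReal
        (|f (σ t)| ^ p * (L ^ (-p) * (Fvol n cn (γ t) * j t))) := by
    intro a ha
    have hFpos : ∀ t ∈ Ioo 0 a, 0 < Fvol n cn (γ t) := fun t ht =>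
      Fvol_pos hcn (h.2.1 t ⟨ht.1.le, ht.2.trans ha.2⟩)
    set g : ℝ → ℝ := (Ioo 0 a).indicator fun t => k t * f (σ t) with hg
    have hgm : Measurable g :=
      (hkm.mul (hfm.comp hσc.measurable)).indicator measurableSet_Ioo
    have hgk : ∀ t ∈ Ioo 0 a, g t = k t * f (σ t) := fun t ht => indicator_of_mem ht _
    have hgle : ∀ t ∈ Ioo 0 a, |g t| ≤ C / L * speed γ t := by
      intro t ht
      rw [hgk t ht, abs_mul, abs_of_nonneg (hk0 t)]
      calc k t * |f (σ t)| ≤ (speed γ t / L) * C := by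
            refine mul_le_mul ?_ (hfC _) (abs_nonneg _) (div_nonneg (speed_nonneg γ t) hLpos.le)
            exact div_le_div_of_nonneg_right (hjs t ⟨ht.1, ht.2.trans ha.2⟩) hLpos.le
        _ = C / L * speed γ t := by ring
    have hgint : ∀ t ∈ Ioo 0 a, ∫ r in (0:ℝ)..t, g r = W (σ t) := by
      intro t ht
      rw [hW]
      simp only [hσ]
      rw [← integral_comp_primitive hki hkm hk0 t ht.1.le hfm]
      refine intervalIntegral.integral_congr_ae (Eventually.of_forall fun r hr => ?_)
      rw [uIoc_of_le ht.1.le] at hr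
      exact hgk r ⟨hr.1, hr.2.trans_lt ht.2⟩
    have main := h.lambdaH_mul_lintegral_le hcn hp ha hgm (div_nonneg hC0 hLpos.le) hgle
      (fun t ht => indicator_of_notMem ht _)
    rw [lintegral_const_mul' _ _ ENNReal.ofReal_ne_top]
    refine le_trans ?_ (main.trans ?_)
    · refine mul_le_mul_right (setLIntegral_mono' measurableSet_Ioo fun t ht => ?_) _
      rw [hgint t ht]
      refine ENNReal.ofReal_le_ofReal (mul_le_mul_of_nonneg_left (mul_le_mul_of_nonneg_left
        (hjs t ⟨ht.1, ht.2.trans ha.2⟩) (hFpos t ht).le) (Real.rpow_nonneg (abs_nonneg _) _))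
    · refine setLIntegral_mono' measurableSet_Ioo fun t ht => ENNReal.ofReal_le_ofReal ?_
      have hF := hFpos t ht
      rw [hgk t ht]
      rcases (hj0 t).eq_or_lt with h0 | h0
      · simp [hk, ← h0, Real.zero_rpow hp0.ne']
      · have hs := hjs t ⟨ht.1, ht.2.trans ha.2⟩
        calc |k t * f (σ t)| ^ p * (Fvol n cn (γ t) * speed γ t ^ (1 - p))
            ≤ |k t * f (σ t)| ^ p * (Fvol n cn (γ t) * j t ^ (1 - p)) := by
              gcongr ?_ * (?_ * ?_)
              exact Real.rpow_le_rpow_of_nonpos h0 hs (by linarith)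
          _ = |f (σ t)| ^ p * (L ^ (-p) * (Fvol n cn (γ t) * (j t ^ p * j t ^ (1 - p)))) := by
              rw [abs_mul, abs_of_nonneg (hk0 t), Real.mul_rpow (hk0 t) (abs_nonneg _),
                Real.div_rpow (hj0 t) hLpos.le, Real.rpow_neg hLpos.le]
              ring
          _ = |f (σ t)| ^ p * (L ^ (-p) * (Fvol n cn (γ t) * j t)) := by
              rw [← Real.rpow_add h0]; simp
  set ρ : ℝ → ℝ := fun t => ((ξ t / (γ t).1) * (η t / (γ t).2)) ^ (n - 1) with hρ
  have hIoo : Ioo (0:ℝ) 1 ⊆ Ico 0 1 := Ioo_subset_Ico_self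
  have hq1 : ∀ t ∈ Ioo (0:ℝ) 1, 0 ≤ ξ t / (γ t).1 := fun t ht =>
    div_nonneg (hξpos t (hIoo ht)).le (h.2.1 t (hIoo ht)).1.le
  have hq2 : ∀ t ∈ Ioo (0:ℝ) 1, 0 ≤ η t / (γ t).2 := fun t ht =>
    div_nonneg (hηpos t (hIoo ht)).le (h.2.1 t (hIoo ht)).2.le
  have hρ0 : ∀ t ∈ Ioo (0:ℝ) 1, 0 ≤ ρ t := fun t ht =>
    pow_nonneg (mul_nonneg (hq1 t ht) (hq2 t ht)) _
  have hρanti : AntitoneOn ρ (Ioo 0 1) := by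
    intro s hs t ht hst
    refine pow_le_pow_left₀ (mul_nonneg (hq1 t ht) (hq2 t ht)) ?_ _
    exact mul_le_mul (hξanti (hIoo hs) (hIoo ht) hst) (hηanti (hIoo hs) (hIoo ht) hst)
      (hq2 t ht) (hq1 s hs)
  have hρm : AEMeasurable ρ (volume.restrict (Ioo 0 1)) :=
    aemeasurable_restrict_of_antitoneOn measurableSet_Ioo hρanti
  have hFρ : ∀ t ∈ Ioo (0:ℝ) 1, Fvol n cn (γ t) * ρ t = cn * (X (σ t) * Y (σ t)) ^ (n - 1) := by
    intro t ht
    have h1 := (h.2.1 t (hIoo ht)).1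
    have h2 := (h.2.1 t (hIoo ht)).2
    have htc : t ∈ Icc (0:ℝ) 1 := Ioo_subset_Icc_self ht
    rw [hXσ t htc, hYσ t htc, Fvol, hρ, mul_assoc, ← mul_pow, mul_assoc, ← mul_pow]
    congr 2
    field_simp
  have hFm := h.aemeasurable_Fvol
  have hweighted := lintegral_mul_antitone_le
    (((hWσ.abs.pow_const p).aemeasurable.mul (hFm.mul hjm.aemeasurable)).ennreal_ofReal.const_mul _)
    ((((hfm.comp hσc.measurable).abs.pow_const p).aemeasurable.mul
      ((hFm.mul hjm.aemeasurable).const_mul _)).ennreal_ofReal) hρm hρanti hρ0 hstopped_le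
  have hjk : ∀ t, j t = L * k t := fun t => by simp only [hk]; field_simp
  have hcv : ∀ (G : ℝ → ℝ), Measurable G → ∀ c : ℝ, 0 ≤ c →
      ∫⁻ t in Ioo (0:ℝ) 1, ENNReal.ofReal (c * (k t * G (σ t)))
        = ENNReal.ofReal c * ∫⁻ τ in Icc (0:ℝ) 1, ENNReal.ofReal (G τ) := by
    intro G hG c hc
    have := lintegral_comp_primitive hki hkm hk0 1 zero_le_one hG.ennreal_ofReal
    rw [show (∫ r in (0:ℝ)..1, k r) = 1 from hσ1] at this
    rw [← this, setLIntegral_Ioo_eq_Icc, ← lintegral_const_mul' _ _ ENNReal.ofReal_ne_top]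
    refine lintegral_congr fun t => ?_
    rw [ENNReal.ofReal_mul hc, ENNReal.ofReal_mul (hk0 t)]
  have e1 : ∫⁻ t in Ioo (0:ℝ) 1, ENNReal.ofReal l * ENNReal.ofReal
      (|W (σ t)| ^ p * (Fvol n cn (γ t) * j t)) * ENNReal.ofReal (ρ t)
      = ENNReal.ofReal (l * (cn * L) * ∫ τ in (0:ℝ)..1, G₁ τ) := by
    rw [ENNReal.ofReal_mul (by positivity), ← setLIntegral_Icc_ofReal_eq hG₁i hG₁0,
      ← hcv G₁ hG₁m _ (by positivity)]
    refine setLIntegral_congr_fun measurableSet_Ioo fun t ht => ?_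
    rw [← ENNReal.ofReal_mul hl0, ← ENNReal.ofReal_mul' (hρ0 t ht)]
    congr 1
    calc _ = l * (|W (σ t)| ^ p * (Fvol n cn (γ t) * ρ t * j t)) := by ring
      _ = _ := by
        rw [hFρ t ht, hjk t]
        simp only [hG₁]
        ring
  have e2 : ∫⁻ t in Ioo (0:ℝ) 1, ENNReal.ofReal
      (|f (σ t)| ^ p * (L ^ (-p) * (Fvol n cn (γ t) * j t))) * ENNReal.ofReal (ρ t)
      = ENNReal.ofReal (L ^ (-p) * (cn * L) * ∫ τ in (0:ℝ)..1, G₂ τ) := by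
    rw [ENNReal.ofReal_mul (by positivity), ← setLIntegral_Icc_ofReal_eq hG₂i hG₂0,
      ← hcv G₂ hG₂m _ (by positivity)]
    refine setLIntegral_congr_fun measurableSet_Ioo fun t ht => ?_
    rw [← ENNReal.ofReal_mul' (hρ0 t ht)]
    congr 1
    calc _ = |f (σ t)| ^ p * (L ^ (-p) * (Fvol n cn (γ t) * ρ t * j t)) := by ring
      _ = _ := by
        rw [hFρ t ht, hjk t]
        simp only [hG₂]
        ring
  have hG₂n : 0 ≤ ∫ τ in (0:ℝ)..1, G₂ τ := intervalIntegral.integral_nonneg zero_le_one hG₂0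
  have hfinal := (ENNReal.ofReal_le_ofReal_iff (by positivity)).1
    (e1.symm.trans_le (hweighted.trans_eq e2))
  have hcL : 0 < cn * L := mul_pos hcn hLpos
  have hLp : L ^ p * L ^ (-p) = 1 := by rw [← Real.rpow_add hLpos]; simp
  have hLp0 : 0 < L ^ p := Real.rpow_pos_of_pos hLpos p
  have := mul_le_mul_of_nonneg_left hfinal hLp0.le
  refine le_of_mul_le_mul_left ?_ hcL
  calc _ = L ^ p * (l * (cn * L) * ∫ τ in (0:ℝ)..1, G₁ τ) := by simp only [hG₁, hW]; ring
    _ ≤ L ^ p * (L ^ (-p) * (cn * L) * ∫ τ in (0:ℝ)..1, G₂ τ) := this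
    _ = (L ^ p * L ^ (-p)) * (cn * L * ∫ τ in (0:ℝ)..1, G₂ τ) := by ring
    _ = _ := by rw [hLp, one_mul]

theorem IsDescent.fst_mem {x0 y0 L : ℝ} {X Y : ℝ → ℝ} (h : IsDescent x0 y0 X Y L) :
    ∀ t ∈ Icc (0:ℝ) 1, X t ∈ Icc 0 x0 := fun t ht =>
  ⟨h.nonneg_fst t ht, h.start_fst ▸ h.anti_fst 0 ⟨le_rfl, zero_le_one⟩ t ht ht.1⟩

theorem IsDescent.snd_mem {x0 y0 L : ℝ} {X Y : ℝ → ℝ} (h : IsDescent x0 y0 X Y L) :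
    ∀ t ∈ Icc (0:ℝ) 1, Y t ∈ Icc 0 y0 := fun t ht =>
  ⟨h.nonneg_snd t ht, h.start_snd ▸ h.anti_snd 0 ⟨le_rfl, zero_le_one⟩ t ht ht.1⟩

theorem IsDescent.length_le {x0 y0 L : ℝ} {X Y : ℝ → ℝ} (h : IsDescent x0 y0 X Y L) :
    L ≤ x0 + y0 := by
  have ho : (1:ℝ) ∈ Icc (0:ℝ) 1 := ⟨zero_le_one, le_rfl⟩
  have := h.lower 0 ⟨le_rfl, zero_le_one⟩ 1 ho zero_le_one
  rw [h.start_fst, h.start_snd] at this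
  linarith [h.nonneg_fst 1 ho, h.nonneg_snd 1 ho]

theorem IsDescent.abs_sub_le {x0 y0 L : ℝ} {X Y : ℝ → ℝ} (h : IsDescent x0 y0 X Y L)
    (hL : 0 ≤ L) : ∀ s ∈ Icc (0:ℝ) 1, ∀ t ∈ Icc (0:ℝ) 1,
      |X s - X t| ≤ L * |s - t| ∧ |Y s - Y t| ≤ L * |s - t| := by
  have main : ∀ s ∈ Icc (0:ℝ) 1, ∀ t ∈ Icc (0:ℝ) 1, s ≤ t →
      |X s - X t| ≤ L * |s - t| ∧ |Y s - Y t| ≤ L * |s - t| := by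
    intro s hs t ht hst
    have hu := h.upper s hs t ht hst
    have h0 : 0 ≤ L * (t - s) := mul_nonneg hL (sub_nonneg.2 hst)
    rw [abs_sub_comm s t, abs_of_nonneg (sub_nonneg.2 hst)]
    exact ⟨abs_le_of_sq_le_sq (by nlinarith [sq_nonneg (Y s - Y t)]) h0,
      abs_le_of_sq_le_sq (by nlinarith [sq_nonneg (X s - X t)]) h0⟩
  intro s hs t ht
  rcases le_total s t with hst | hst
  · exact main s hs t ht hst
  · rw [abs_sub_comm (X s), abs_sub_comm (Y s), abs_sub_comm s]
    exact main t ht s hs hst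

theorem IsDescent.of_tendsto {x0 y0 L : ℝ} {X Y : ℝ → ℝ} {A B : ℕ → ℝ → ℝ} {l : ℕ → ℝ}
    (h : ∀ k, IsDescent x0 y0 (A k) (B k) (l k))
    (hX : ∀ t ∈ Icc (0:ℝ) 1, Tendsto (fun k => A k t) atTop (𝓝 (X t)))
    (hY : ∀ t ∈ Icc (0:ℝ) 1, Tendsto (fun k => B k t) atTop (𝓝 (Y t)))
    (hL : Tendsto l atTop (𝓝 L)) : IsDescent x0 y0 X Y L := by
  have hz : (0:ℝ) ∈ Icc (0:ℝ) 1 := ⟨le_rfl, zero_le_one⟩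
  have ho : (1:ℝ) ∈ Icc (0:ℝ) 1 := ⟨zero_le_one, le_rfl⟩
  refine ⟨?_, ?_, ?_, ?_, ?_, ?_, ?_, ?_, ?_⟩
  · exact tendsto_nhds_unique (hX 0 hz) (tendsto_const_nhds.congr fun k => (h k).start_fst.symm)
  · exact tendsto_nhds_unique (hY 0 hz) (tendsto_const_nhds.congr fun k => (h k).start_snd.symm)
  · exact tendsto_nhds_unique ((hX 1 ho).mul (hY 1 ho))
      (tendsto_const_nhds.congr fun k => (h k).end_eq.symm)
  · exact fun t ht => ge_of_tendsto' (hX t ht) fun k => (h k).nonneg_fst t ht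
  · exact fun t ht => ge_of_tendsto' (hY t ht) fun k => (h k).nonneg_snd t ht
  · exact fun s hs t ht hst =>
      le_of_tendsto_of_tendsto' (hX t ht) (hX s hs) fun k => (h k).anti_fst s hs t ht hst
  · exact fun s hs t ht hst =>
      le_of_tendsto_of_tendsto' (hY t ht) (hY s hs) fun k => (h k).anti_snd s hs t ht hst
  · exact fun s hs t ht hst => le_of_tendsto_of_tendsto'
      ((((hX s hs).sub (hX t ht)).pow 2).add (((hY s hs).sub (hY t ht)).pow 2))
      ((hL.mul_const _).pow 2) fun k => (h k).upper s hs t ht hst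
  · exact fun s hs t ht hst => le_of_tendsto_of_tendsto' (hL.mul_const _)
      (((hX s hs).sub (hX t ht)).add ((hY s hs).sub (hY t ht)))
      fun k => (h k).lower s hs t ht hst

theorem HardyIneq.of_tendsto {n : ℕ} {p x0 y0 L c : ℝ} (hp : 0 < p) {X Y : ℝ → ℝ}
    {A B : ℕ → ℝ → ℝ} {l : ℕ → ℝ} (hA : ∀ k, Continuous (A k)) (hB : ∀ k, Continuous (B k))
    (h : ∀ k, IsDescent x0 y0 (A k) (B k) (l k)) (hH : ∀ k, HardyIneq n p (A k) (B k) (l k) c)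
    (hX : ∀ t ∈ Icc (0:ℝ) 1, Tendsto (fun k => A k t) atTop (𝓝 (X t)))
    (hY : ∀ t ∈ Icc (0:ℝ) 1, Tendsto (fun k => B k t) atTop (𝓝 (Y t)))
    (hL : Tendsto l atTop (𝓝 L)) : HardyIneq n p X Y L c := by
  rintro f hf ⟨C, hC⟩
  have hC0 : 0 ≤ C := (abs_nonneg _).trans (hC 0)
  have lim : ∀ q : ℝ → ℝ, Measurable q → (∀ t ∈ Icc (0:ℝ) 1, |q t| ≤ C) →
      Tendsto (fun k => ∫ τ in (0:ℝ)..1, |q τ| ^ p * (A k τ * B k τ) ^ (n - 1)) atTop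
        (𝓝 (∫ τ in (0:ℝ)..1, |q τ| ^ p * (X τ * Y τ) ^ (n - 1))) := by
    intro q hq hqC
    refine intervalIntegral.tendsto_integral_filter_of_dominated_convergence
      (fun _ => C ^ p * (x0 * y0) ^ (n - 1)) (Eventually.of_forall fun k => ?_)
      (Eventually.of_forall fun k => Eventually.of_forall fun t ht => ?_)
      intervalIntegrable_const (Eventually.of_forall fun t ht => ?_)
    · exact ((hq.abs.pow_const p).mul
        (((hA k).mul (hB k)).pow _).measurable).aestronglyMeasurable
    · rw [uIoc_of_le zero_le_one] at ht
      have ht' : t ∈ Icc (0:ℝ) 1 := ⟨ht.1.le, ht.2⟩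
      have hx := (h k).fst_mem t ht'
      have hy := (h k).snd_mem t ht'
      have hxy := mul_nonneg hx.1 hy.1
      rw [Real.norm_eq_abs, abs_of_nonneg (by positivity)]
      exact mul_le_mul (Real.rpow_le_rpow (abs_nonneg _) (hqC t ht') hp.le)
        (pow_le_pow_left₀ hxy (mul_le_mul hx.2 hy.2 hy.1 (hx.1.trans hx.2)) _) (by positivity)
        (by positivity)
    · rw [uIoc_of_le zero_le_one] at ht
      have ht' : t ∈ Icc (0:ℝ) 1 := ⟨ht.1.le, ht.2⟩
      exact (((hX t ht').mul (hY t ht')).pow _).const_mul _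
  have hfi : ∀ a b, IntervalIntegrable f volume a b := fun a b =>
    (intervalIntegrable_const (c := C)).mono_fun hf.aestronglyMeasurable
      (Eventually.of_forall fun t => (hC t).trans (le_abs_self C))
  refine le_of_tendsto_of_tendsto' (((hL.rpow_const (Or.inr hp.le)).const_mul c).mul
    (lim (fun τ => ∫ r in (0:ℝ)..τ, f r)
      (intervalIntegral.continuous_primitive hfi 0).measurable (bounded_primitive hC)))
    (lim f hf fun t _ => hC t) fun k => hH k f hf ⟨C, hC⟩

theorem HardyIneq.mono {n : ℕ} {p x0 y0 L c c' : ℝ} {X Y : ℝ → ℝ} (h : IsDescent x0 y0 X Y L)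
    (hL : 0 ≤ L) (hcc : c ≤ c') (hH : HardyIneq n p X Y L c') : HardyIneq n p X Y L c := by
  intro f hf hC
  refine le_trans ?_ (hH f hf hC)
  refine mul_le_mul_of_nonneg_right
    (mul_le_mul_of_nonneg_right hcc (Real.rpow_nonneg hL p)) ?_
  refine intervalIntegral.integral_nonneg zero_le_one fun t ht => ?_
  have := mul_nonneg (h.nonneg_fst t ht) (h.nonneg_snd t ht)
  positivity

theorem isCompact_lipschitz_profiles (M : NNReal) (x0 y0 : ℝ) :
    IsCompact {φ : BoundedContinuousFunction unitInterval (ℝ × ℝ) |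
      (∀ t, φ t ∈ Icc (0:ℝ) x0 ×ˢ Icc (0:ℝ) y0) ∧ LipschitzWith M φ} := by
  refine BoundedContinuousFunction.arzela_ascoli₂ (Icc (0:ℝ) x0 ×ˢ Icc (0:ℝ) y0)
    (isCompact_Icc.prod isCompact_Icc) _ ?_ (fun f x hf => hf.1 x) ?_
  · have he : ∀ t : unitInterval, Continuous
        fun φ : BoundedContinuousFunction unitInterval (ℝ × ℝ) => φ t := fun t =>
      (BoundedContinuousFunction.lipschitz_eval_const t).continuous
    refine IsClosed.inter (s₁ := {φ : BoundedContinuousFunction unitInterval (ℝ × ℝ) |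
      ∀ t, φ t ∈ Icc (0:ℝ) x0 ×ˢ Icc (0:ℝ) y0})
      (s₂ := {φ : BoundedContinuousFunction unitInterval (ℝ × ℝ) | LipschitzWith M φ}) ?_ ?_
    · simp only [ofPred_forall]
      exact isClosed_iInter fun t => (isClosed_Icc.prod isClosed_Icc).preimage (he t)
    · simp only [lipschitzWith_iff_dist_le_mul, ofPred_forall]
      exact isClosed_iInter fun s => isClosed_iInter fun t =>
        isClosed_le ((he s).dist (he t)) continuous_const
  · exact (LipschitzWith.uniformEquicontinuous _ M fun φ => φ.2.2).equicontinuous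

/-- There is a single descent satisfying every Hardy inequality that some descent satisfies. -/
theorem exists_optimal_isDescent (n : ℕ) {p x0 y0 : ℝ} (hp : 0 < p) (hx0 : 0 < x0)
    (hy0 : 0 < y0) :
    ∃ (X Y : ℝ → ℝ) (L : ℝ), Continuous X ∧ Continuous Y ∧ 0 ≤ L ∧ IsDescent x0 y0 X Y L ∧
      ∀ c, (∃ (A B : ℝ → ℝ) (l : ℝ), Continuous A ∧ Continuous B ∧ 0 ≤ l ∧
        IsDescent x0 y0 A B l ∧ HardyIneq n p A B l c) → HardyIneq n p X Y L c := by
  set S : Set ℝ := {c | ∃ (A B : ℝ → ℝ) (l : ℝ), Continuous A ∧ Continuous B ∧ 0 ≤ l ∧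
        IsDescent x0 y0 A B l ∧ HardyIneq n p A B l c} with hS
  set M : NNReal := (x0 + y0).toNNReal with hM
  have hMc : (M : ℝ) = x0 + y0 := Real.coe_toNNReal _ (by positivity)
  set fstP : BoundedContinuousFunction unitInterval (ℝ × ℝ) → ℝ → ℝ :=
    fun φ t => (φ (projIcc 0 1 zero_le_one t)).1 with hfst
  set sndP : BoundedContinuousFunction unitInterval (ℝ × ℝ) → ℝ → ℝ :=
    fun φ t => (φ (projIcc 0 1 zero_le_one t)).2 with hsnd
  have hfc : ∀ φ, Continuous (fstP φ) := fun φ => (φ.continuous.comp continuous_projIcc).fst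
  have hsc : ∀ φ, Continuous (sndP φ) := fun φ => (φ.continuous.comp continuous_projIcc).snd
  set D : Set (BoundedContinuousFunction unitInterval (ℝ × ℝ) × ℝ) :=
    {φ : BoundedContinuousFunction unitInterval (ℝ × ℝ) |
      (∀ t, φ t ∈ Icc (0:ℝ) x0 ×ˢ Icc (0:ℝ) y0) ∧ LipschitzWith M φ} ×ˢ Icc 0 (x0 + y0) with hD
  have hDc : IsCompact D := (isCompact_lipschitz_profiles M x0 y0).prod isCompact_Icc
  set T : ℝ → Set (BoundedContinuousFunction unitInterval (ℝ × ℝ) × ℝ) := fun c =>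
    {z | z ∈ D ∧ IsDescent x0 y0 (fstP z.1) (sndP z.1) z.2 ∧
      HardyIneq n p (fstP z.1) (sndP z.1) z.2 c} with hT
  have hTclosed : ∀ c, IsClosed (T c) := by
    refine fun c => IsSeqClosed.isClosed fun u z hu huz => ?_
    have h1 : Tendsto (fun k => (u k).1) atTop (𝓝 z.1) := (continuous_fst.tendsto z).comp huz
    have h2 : Tendsto (fun k => (u k).2) atTop (𝓝 z.2) := (continuous_snd.tendsto z).comp huz
    have hev : ∀ t, Tendsto (fun k => (u k).1 t) atTop (𝓝 (z.1 t)) := fun t =>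
      ((BoundedContinuousFunction.lipschitz_eval_const t).continuous.tendsto z.1).comp h1
    have hf : ∀ t ∈ Icc (0:ℝ) 1, Tendsto (fun k => fstP (u k).1 t) atTop (𝓝 (fstP z.1 t)) :=
      fun t _ => (continuous_fst.tendsto _).comp (hev _)
    have hs : ∀ t ∈ Icc (0:ℝ) 1, Tendsto (fun k => sndP (u k).1 t) atTop (𝓝 (sndP z.1 t)) :=
      fun t _ => (continuous_snd.tendsto _).comp (hev _)
    exact ⟨hDc.isClosed.mem_of_tendsto huz (Eventually.of_forall fun k => (hu k).1),
      IsDescent.of_tendsto (fun k => (hu k).2.1) hf hs h2,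
      HardyIneq.of_tendsto hp (fun k => hfc _) (fun k => hsc _) (fun k => (hu k).2.1)
        (fun k => (hu k).2.2) hf hs h2⟩
  have hTcompact : ∀ c, IsCompact (T c) := fun c =>
    hDc.of_isClosed_subset (hTclosed c) fun z hz => hz.1
  have hTne : ∀ c ∈ S, (T c).Nonempty := by
    rintro c ⟨A, B, l, hA, hB, hl, hd, hH⟩
    set φ : BoundedContinuousFunction unitInterval (ℝ × ℝ) :=
      BoundedContinuousFunction.mkOfCompact ⟨fun t => (A t, B t), by fun_prop⟩ with hφ
    have h1 : ∀ t ∈ Icc (0:ℝ) 1, Tendsto (fun _ : ℕ => A t) atTop (𝓝 (fstP φ t)) := by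
      intro t ht
      have : fstP φ t = A t := by simp [hfst, hφ, projIcc_of_mem zero_le_one ht]
      rw [this]
      exact tendsto_const_nhds
    have h2 : ∀ t ∈ Icc (0:ℝ) 1, Tendsto (fun _ : ℕ => B t) atTop (𝓝 (sndP φ t)) := by
      intro t ht
      have : sndP φ t = B t := by simp [hsnd, hφ, projIcc_of_mem zero_le_one ht]
      rw [this]
      exact tendsto_const_nhds
    refine ⟨(φ, l), ⟨⟨fun t => ⟨hd.fst_mem t t.2, hd.snd_mem t t.2⟩, ?_⟩, hl, hd.length_le⟩,
      IsDescent.of_tendsto (fun _ => hd) h1 h2 tendsto_const_nhds,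
      HardyIneq.of_tendsto hp (fun _ => hA) (fun _ => hB) (fun _ => hd) (fun _ => hH) h1 h2
        tendsto_const_nhds⟩
    refine LipschitzWith.of_dist_le_mul fun s t => ?_
    have hst := hd.abs_sub_le hl s s.2 t t.2
    have hle : l * |(s:ℝ) - t| ≤ M * dist s t := by
      rw [hMc]
      exact mul_le_mul_of_nonneg_right hd.length_le (abs_nonneg _)
    exact max_le (hst.1.trans hle) (hst.2.trans hle)
  have hzero : (0:ℝ) ∈ S := by
    refine ⟨fun _ => x0, fun t => y0 * (1 - t), y0, continuous_const, by fun_prop, hy0.le,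
      ⟨rfl, by simp, by simp, fun _ _ => hx0.le,
        fun t ht => mul_nonneg hy0.le (by linarith [ht.2]), fun _ _ _ _ _ => le_rfl,
        fun s _ t _ hst => mul_le_mul_of_nonneg_left (by linarith) hy0.le,
        fun s _ t _ _ => le_of_eq (by ring), fun s _ t _ _ => le_of_eq (by ring)⟩, ?_⟩
    intro f _ _
    rw [zero_mul, zero_mul]
    refine intervalIntegral.integral_nonneg zero_le_one fun t ht => ?_
    have := mul_nonneg hx0.le (mul_nonneg hy0.le (sub_nonneg.2 ht.2))
    positivity
  have : Nonempty S := ⟨⟨0, hzero⟩⟩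
  obtain ⟨z, hz⟩ := IsCompact.nonempty_iInter_of_directed_nonempty_isCompact_isClosed
    (fun c : S => T c) (by
      intro c c'
      refine ⟨⟨max c c', ?_⟩, ?_, ?_⟩
      · rcases max_choice (c:ℝ) c' with h | h <;> rw [h]
        exacts [c.2, c'.2]
      · exact fun z hz => ⟨hz.1, hz.2.1, hz.2.2.mono hz.2.1 hz.1.2.1 (le_max_left _ _)⟩
      · exact fun z hz => ⟨hz.1, hz.2.1, hz.2.2.mono hz.2.1 hz.1.2.1 (le_max_right _ _)⟩)
    (fun c => hTne c c.2) (fun c => hTcompact c) (fun c => hTclosed c)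
  rw [mem_iInter] at hz
  have h0 := hz ⟨0, hzero⟩
  exact ⟨fstP z.1, sndP z.1, z.2, hfc _, hsc _, h0.1.2.1, h0.2.1, fun c hc => (hz ⟨c, hc⟩).2.2⟩

theorem HardyIneq.comp_mul_left {n : ℕ} {p x0 y0 L c T : ℝ} {X Y : ℝ → ℝ} (hp : 0 < p)
    (hX : Continuous X) (hY : Continuous Y) (hL : 0 ≤ L) (hd : IsDescent x0 y0 X Y L)
    (hc : 0 ≤ c) (hT0 : 0 < T) (hT1 : T ≤ 1) (h : HardyIneq n p X Y L c) :
    HardyIneq n p (fun t => X (T * t)) (fun t => Y (T * t)) (L * T) c := by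
  rintro f hf ⟨C, hC⟩
  have hC0 : 0 ≤ C := (abs_nonneg _).trans (hC 0)
  set g : ℝ → ℝ := indicator {τ | τ ≤ T} fun τ => f (T⁻¹ * τ) with hg
  have hgm : Measurable g := (hf.comp (measurable_const_mul _)).indicator measurableSet_Iic
  have hgC : ∀ t, |g t| ≤ C := by
    intro t
    by_cases ht : t ∈ {τ | τ ≤ T}
    · rw [hg, indicator_of_mem ht]
      exact hC _
    · rw [hg, indicator_of_notMem ht, abs_zero]
      exact hC0
  have hgT : ∀ r ≤ (1:ℝ), g (T * r) = f r := by
    intro r hr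
    rw [hg, indicator_of_mem (show T * r ∈ {τ | τ ≤ T} from mul_le_of_le_one_right hT0.le hr),
      inv_mul_cancel_left₀ hT0.ne']
  have hgi : ∀ a b, IntervalIntegrable g volume a b := fun a b =>
    (intervalIntegrable_const (c := C)).mono_fun hgm.aestronglyMeasurable
      (Eventually.of_forall fun t => (hgC t).trans (le_abs_self C))
  set W : ℝ → ℝ := fun τ => ∫ r in (0:ℝ)..τ, g r with hW
  have hWm : Measurable W := (intervalIntegral.continuous_primitive hgi 0).measurable
  have hWT : ∀ s ∈ Icc (0:ℝ) 1, W (T * s) = T * ∫ r in (0:ℝ)..s, f r := by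
    intro s hs
    have := intervalIntegral.mul_integral_comp_mul_left (a := 0) (b := s) (f := g) T
    rw [mul_zero] at this
    simp only [hW]
    rw [← this]
    congr 1
    refine intervalIntegral.integral_congr fun r hr => ?_
    rw [uIcc_of_le hs.1] at hr
    exact hgT r (hr.2.trans hs.2)
  have hVc : Continuous fun τ => (X τ * Y τ) ^ (n - 1) := (hX.mul hY).pow _
  have hV0 : ∀ τ ∈ Icc (0:ℝ) 1, 0 ≤ (X τ * Y τ) ^ (n - 1) := fun τ hτ =>
    pow_nonneg (mul_nonneg (hd.nonneg_fst τ hτ) (hd.nonneg_snd τ hτ)) _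
  have hleft : T * ∫ s in (0:ℝ)..1, |W (T * s)| ^ p * (X (T * s) * Y (T * s)) ^ (n - 1)
      ≤ ∫ τ in (0:ℝ)..1, |W τ| ^ p * (X τ * Y τ) ^ (n - 1) := by
    rw [intervalIntegral.mul_integral_comp_mul_left
      (f := fun τ => |W τ| ^ p * (X τ * Y τ) ^ (n - 1)), mul_zero, mul_one]
    refine intervalIntegral.integral_mono_interval le_rfl hT0.le hT1 ?_
      ((intervalIntegrable_abs_rpow hp.le hWm fun t ht =>
      bounded_primitive hgC t ⟨ht.1.le, ht.2.le⟩).mul_continuousOn hVc.continuousOn)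
    rw [EventuallyLE, ae_restrict_iff' measurableSet_Ioc]
    exact Eventually.of_forall fun τ hτ =>
      mul_nonneg (Real.rpow_nonneg (abs_nonneg _) _) (hV0 τ ⟨hτ.1.le, hτ.2⟩)
  have hright : ∫ τ in (0:ℝ)..1, |g τ| ^ p * (X τ * Y τ) ^ (n - 1)
      = T * ∫ s in (0:ℝ)..1, |f s| ^ p * (X (T * s) * Y (T * s)) ^ (n - 1) := by
    have e1 : (fun τ => |g τ| ^ p * (X τ * Y τ) ^ (n - 1))
        = indicator {τ | τ ≤ T} fun τ => |f (T⁻¹ * τ)| ^ p * (X τ * Y τ) ^ (n - 1) := by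
      funext τ
      by_cases hτ : τ ∈ {τ | τ ≤ T}
      · rw [hg, indicator_of_mem hτ, indicator_of_mem hτ]
      · rw [hg, indicator_of_notMem hτ, indicator_of_notMem hτ, abs_zero,
          Real.zero_rpow hp.ne', zero_mul]
    have e2 := intervalIntegral.mul_integral_comp_mul_left (a := 0) (b := 1)
      (f := fun τ => |f (T⁻¹ * τ)| ^ p * (X τ * Y τ) ^ (n - 1)) T
    simp only [inv_mul_cancel_left₀ hT0.ne', mul_zero, mul_one] at e2
    rw [e1, intervalIntegral.integral_indicator ⟨hT0.le, hT1⟩, e2]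
  have hH := h g hgm ⟨C, hgC⟩
  have hcL : 0 ≤ c * L ^ p := mul_nonneg hc (Real.rpow_nonneg hL p)
  have hT := (mul_le_mul_of_nonneg_left hleft hcL).trans (hH.trans_eq hright)
  have e3 : ∫ s in (0:ℝ)..1, |W (T * s)| ^ p * (X (T * s) * Y (T * s)) ^ (n - 1)
      = T ^ p * ∫ s in (0:ℝ)..1,
        |∫ r in (0:ℝ)..s, f r| ^ p * (X (T * s) * Y (T * s)) ^ (n - 1) := by
    rw [← intervalIntegral.integral_const_mul]
    refine intervalIntegral.integral_congr fun s hs => ?_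
    rw [uIcc_of_le zero_le_one] at hs
    simp only [hWT s hs, abs_mul, abs_of_pos hT0]
    rw [Real.mul_rpow hT0.le (abs_nonneg _), mul_assoc]
  rw [e3] at hT
  refine le_of_mul_le_mul_left ?_ hT0
  rw [Real.mul_rpow hL hT0.le]
  refine le_trans (le_of_eq ?_) hT
  ring

/-- A descent can be stopped when it first meets the boundary of the quadrant. -/
theorem IsDescent.exists_pos_on_Ico {x0 y0 L : ℝ} {X Y : ℝ → ℝ} (hx0 : 0 < x0) (hy0 : 0 < y0)
    (hX : Continuous X) (hY : Continuous Y) (hL : 0 ≤ L) (hd : IsDescent x0 y0 X Y L) :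
    ∃ T, 0 < T ∧ T ≤ 1 ∧ 0 < L ∧
      IsDescent x0 y0 (fun t => X (T * t)) (fun t => Y (T * t)) (L * T) ∧
      ∀ t ∈ Ico (0:ℝ) 1, 0 < X (T * t) ∧ 0 < Y (T * t) := by
  have hz : (0:ℝ) ∈ Icc (0:ℝ) 1 := ⟨le_rfl, zero_le_one⟩
  have ho : (1:ℝ) ∈ Icc (0:ℝ) 1 := ⟨zero_le_one, le_rfl⟩
  set Z : Set ℝ := Icc 0 1 ∩ {t | X t * Y t = 0} with hZ
  have hZc : IsCompact Z :=
    isCompact_Icc.inter_right (isClosed_eq (hX.mul hY) continuous_const)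
  have hZne : Z.Nonempty := ⟨1, ho, hd.end_eq⟩
  have hmem : sInf Z ∈ Z := hZc.sInf_mem hZne
  set T := sInf Z with hT
  have hT0 : 0 < T := by
    rcases hmem.1.1.eq_or_lt with h | h
    · have := hmem.2
      rw [← h, mem_ofPred_eq, hd.start_fst, hd.start_snd] at this
      exact absurd this (mul_pos hx0 hy0).ne'
    · exact h
  have hT1 : T ≤ 1 := hmem.1.2
  have hmap : ∀ t ∈ Icc (0:ℝ) 1, T * t ∈ Icc (0:ℝ) 1 := fun t ht =>
    ⟨mul_nonneg hT0.le ht.1, mul_le_one₀ hT1 ht.1 ht.2⟩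
  have hmono : ∀ {s t : ℝ}, s ≤ t → T * s ≤ T * t := fun h => mul_le_mul_of_nonneg_left h hT0.le
  refine ⟨T, hT0, hT1, ?_, ⟨?_, ?_, ?_, ?_, ?_, ?_, ?_, ?_, ?_⟩, ?_⟩
  · refine hL.lt_of_ne fun h => ?_
    have h1 := hd.abs_sub_le hL 0 hz 1 ho
    rw [← h, zero_mul] at h1
    have hx : X 0 = X 1 := sub_eq_zero.1 (abs_nonpos_iff.1 h1.1)
    have hy : Y 0 = Y 1 := sub_eq_zero.1 (abs_nonpos_iff.1 h1.2)
    have := hd.end_eq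
    rw [← hx, ← hy, hd.start_fst, hd.start_snd] at this
    exact absurd this (mul_pos hx0 hy0).ne'
  · simp [hd.start_fst]
  · simp [hd.start_snd]
  · simpa using hmem.2
  · exact fun t ht => hd.nonneg_fst _ (hmap t ht)
  · exact fun t ht => hd.nonneg_snd _ (hmap t ht)
  · exact fun s hs t ht hst => hd.anti_fst _ (hmap s hs) _ (hmap t ht) (hmono hst)
  · exact fun s hs t ht hst => hd.anti_snd _ (hmap s hs) _ (hmap t ht) (hmono hst)
  · exact fun s hs t ht hst => (hd.upper _ (hmap s hs) _ (hmap t ht) (hmono hst)).trans_eq (by ring)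
  · exact fun s hs t ht hst =>
      le_trans (le_of_eq (by ring)) (hd.lower _ (hmap s hs) _ (hmap t ht) (hmono hst))
  · intro t ht
    have ht' := hmap t ⟨ht.1, ht.2.le⟩
    have hne : X (T * t) * Y (T * t) ≠ 0 := fun h0 => by
      have := csInf_le hZc.bddBelow (⟨ht', h0⟩ : T * t ∈ Z)
      rw [← hT] at this
      nlinarith [ht.2]
    exact ⟨(hd.nonneg_fst _ ht').lt_of_ne' (left_ne_zero_of_mul hne),
      (hd.nonneg_snd _ ht').lt_of_ne' (right_ne_zero_of_mul hne)⟩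

/-- The inverse of `(x, y) ↦ ((x² - y²) / 2, x y)` on the quarter plane. -/
def invUV (z : ℝ × ℝ) : ℝ × ℝ :=
  (√(√(z.1 ^ 2 + z.2 ^ 2) + z.1), √(√(z.1 ^ 2 + z.2 ^ 2) - z.1))

theorem abs_fst_le_sqrt (z : ℝ × ℝ) : |z.1| ≤ √(z.1 ^ 2 + z.2 ^ 2) :=
  Real.abs_le_sqrt (by nlinarith [sq_nonneg z.2])

theorem invUV_fst_sq (z : ℝ × ℝ) : (invUV z).1 ^ 2 = √(z.1 ^ 2 + z.2 ^ 2) + z.1 :=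
  Real.sq_sqrt (by linarith [(abs_le.1 (abs_fst_le_sqrt z)).1])

theorem invUV_snd_sq (z : ℝ × ℝ) : (invUV z).2 ^ 2 = √(z.1 ^ 2 + z.2 ^ 2) - z.1 :=
  Real.sq_sqrt (by linarith [(abs_le.1 (abs_fst_le_sqrt z)).2])

theorem ucoord_invUV (z : ℝ × ℝ) : ucoord (invUV z) = z.1 := by
  rw [ucoord, invUV_fst_sq, invUV_snd_sq]
  ring

theorem invUV_fst_nonneg (z : ℝ × ℝ) : 0 ≤ (invUV z).1 := Real.sqrt_nonneg _

theorem invUV_snd_nonneg (z : ℝ × ℝ) : 0 ≤ (invUV z).2 := Real.sqrt_nonneg _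

theorem invUV_fst_mul_snd {z : ℝ × ℝ} (hz : 0 ≤ z.2) : (invUV z).1 * (invUV z).2 = z.2 := by
  rw [← sq_eq_sq₀ (mul_nonneg (invUV_fst_nonneg z) (invUV_snd_nonneg z)) hz, mul_pow,
    invUV_fst_sq, invUV_snd_sq]
  nlinarith [Real.sq_sqrt (add_nonneg (sq_nonneg z.1) (sq_nonneg z.2))]

theorem invUV_ucoord_vcoord {x y : ℝ} (hx : 0 ≤ x) (hy : 0 ≤ y) :
    invUV ((x ^ 2 - y ^ 2) / 2, x * y) = (x, y) := by
  have h : √(((x ^ 2 - y ^ 2) / 2) ^ 2 + (x * y) ^ 2) = (x ^ 2 + y ^ 2) / 2 := by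
    rw [Real.sqrt_eq_iff_mul_self_eq (by positivity) (by positivity)]
    ring
  rw [invUV]
  simp only [h]
  rw [show (x ^ 2 + y ^ 2) / 2 + (x ^ 2 - y ^ 2) / 2 = x ^ 2 by ring,
    show (x ^ 2 + y ^ 2) / 2 - (x ^ 2 - y ^ 2) / 2 = y ^ 2 by ring, Real.sqrt_sq hx,
    Real.sqrt_sq hy]

theorem continuous_invUV : Continuous invUV := by
  unfold invUV
  fun_prop

theorem invUV_pos {z : ℝ × ℝ} (hz : 0 < z.2) : 0 < (invUV z).1 ∧ 0 < (invUV z).2 := by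
  have h := invUV_fst_mul_snd hz.le
  constructor
  · refine (invUV_fst_nonneg z).lt_of_ne fun h0 => ?_
    rw [← h0, zero_mul] at h
    exact hz.ne h
  · refine (invUV_snd_nonneg z).lt_of_ne fun h0 => ?_
    rw [← h0, mul_zero] at h
    exact hz.ne h

theorem contDiffAt_invUV {z : ℝ × ℝ} (hz : 0 < z.2) : ContDiffAt ℝ 1 invUV z := by
  have hr : ContDiffAt ℝ 1 (fun z : ℝ × ℝ => √(z.1 ^ 2 + z.2 ^ 2)) z :=
    ContDiffAt.sqrt ((contDiffAt_fst.pow 2).add (contDiffAt_snd.pow 2)) (by positivity)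
  have h := invUV_pos hz
  exact ((hr.add contDiffAt_fst).sqrt (Real.sqrt_pos.1 h.1).ne').prodMk
    ((hr.sub contDiffAt_fst).sqrt (Real.sqrt_pos.1 h.2).ne')

theorem exists_lipschitzOnWith_invUV {s : Set (ℝ × ℝ)} (hs : IsCompact s)
    (hpos : ∀ z ∈ s, 0 < z.2) : ∃ K, LipschitzOnWith K invUV s := by
  refine LocallyLipschitzOn.exists_lipschitzOnWith_of_compact hs fun z hz => ?_
  obtain ⟨K, t, ht, hK⟩ := (contDiffAt_invUV (hpos z hz)).exists_lipschitzOnWith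
  exact ⟨K, t, mem_nhdsWithin_of_mem_nhds ht, hK⟩

theorem IsDescent.deriv_bounds {x0 y0 L : ℝ} {X Y : ℝ → ℝ} (h : IsDescent x0 y0 X Y L)
    {t X' Y' : ℝ} (ht : t ∈ Ioo (0:ℝ) 1) (hX : HasDerivAt X X' t) (hY : HasDerivAt Y Y' t) :
    X' ^ 2 + Y' ^ 2 ≤ L ^ 2 ∧ L ≤ -X' - Y' := by
  have hle : 𝓝[>] t ≤ 𝓝[≠] t := nhdsWithin_mono _ fun s hs => ne_of_gt hs
  have hX := (hasDerivAt_iff_tendsto_slope.1 hX).mono_left hle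
  have hY := (hasDerivAt_iff_tendsto_slope.1 hY).mono_left hle
  have hev : ∀ᶠ s in 𝓝[>] t, s ∈ Ioo t 1 := Ioo_mem_nhdsGT ht.2
  have htI : t ∈ Icc (0:ℝ) 1 := ⟨ht.1.le, ht.2.le⟩
  constructor
  · refine le_of_tendsto ((hX.pow 2).add (hY.pow 2)) ?_
    filter_upwards [hev] with s hs
    have := h.upper t htI s ⟨htI.1.trans hs.1.le, hs.2.le⟩ hs.1.le
    have hst : 0 < s - t := sub_pos.2 hs.1
    rw [slope_def_field, slope_def_field, div_pow, div_pow, ← add_div, div_le_iff₀ (by positivity)]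
    nlinarith
  · refine ge_of_tendsto (hX.neg.sub hY) ?_
    filter_upwards [hev] with s hs
    have := h.lower t htI s ⟨htI.1.trans hs.1.le, hs.2.le⟩ hs.1.le
    have hst : 0 < s - t := sub_pos.2 hs.1
    rw [slope_def_field, slope_def_field, ← neg_div, ← sub_div, le_div_iff₀ hst]
    linarith

theorem IsDescent.lipschitzOnWith_of_abs_sub_le {x0 y0 L : ℝ} {X Y : ℝ → ℝ}
    (hx0 : 0 ≤ x0) (hy0 : 0 ≤ y0) (hL : 0 ≤ L) (h : IsDescent x0 y0 X Y L) {G : ℝ → ℝ}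
    (hG : ∀ s t, |G s - G t| ≤ |X s - X t| * (|X s + X t| + |Y s + Y t|)
      + |Y s - Y t| * (|X s + X t| + |Y s + Y t|)) :
    LipschitzOnWith (4 * L * (x0 + y0)).toNNReal G (Icc 0 1) := by
  refine LipschitzOnWith.of_dist_le_mul fun s hs t ht => ?_
  rw [Real.dist_eq, Real.dist_eq, Real.coe_toNNReal _ (by positivity)]
  have h1 := h.abs_sub_le hL s hs t ht
  have hxs := h.fst_mem s hs
  have hxt := h.fst_mem t ht
  have hys := h.snd_mem s hs
  have hyt := h.snd_mem t ht
  have hS : |X s + X t| + |Y s + Y t| ≤ 2 * (x0 + y0) := by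
    rw [abs_of_nonneg (add_nonneg hxs.1 hxt.1), abs_of_nonneg (add_nonneg hys.1 hyt.1)]
    linarith [hxs.2, hxt.2, hys.2, hyt.2]
  have hS0 : 0 ≤ |X s + X t| + |Y s + Y t| := by positivity
  calc |G s - G t| ≤ _ := hG s t
    _ ≤ L * |s - t| * (2 * (x0 + y0)) + L * |s - t| * (2 * (x0 + y0)) := by
        gcongr
        · exact h1.1
        · exact h1.2
    _ = 4 * L * (x0 + y0) * |s - t| := by ring

theorem speed_invUV {L x0 y0 t X' Y' U' : ℝ} {X Y U : ℝ → ℝ} (hd : IsDescent x0 y0 X Y L)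
    (hL : 0 < L) (ht : t ∈ Ioo (0:ℝ) 1) (hXY : 0 < X t * Y t) (hX : HasDerivAt X X' t)
    (hY : HasDerivAt Y Y' t) (hU : HasDerivAt U U' t) (hU' : |U'| = |X t * X' - Y t * Y'|)
    (hUt : |(X t ^ 2 - Y t ^ 2) / 2| ≤ U t) :
    0 < speed (fun s => invUV (U s, X s * Y s)) t ∧
      speed (fun s => invUV (U s, X s * Y s)) t ≤ L := by
  have hV := hX.mul hY
  have hVe : ∀ᶠ s in 𝓝 t, 0 < X s * Y s := hV.continuousAt.eventually_const_lt hXY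
  have hdiff : DifferentiableAt ℝ (fun s => invUV (U s, X s * Y s)) t :=
    ((contDiffAt_invUV (z := (U t, X t * Y t)) hXY).differentiableAt one_ne_zero).comp t
      (f := fun s => (U s, X s * Y s)) (hU.differentiableAt.prodMk hV.differentiableAt)
  have ha : HasDerivAt (fun s => (invUV (U s, X s * Y s)).1) _ t := hdiff.fst.hasDerivAt
  have hb : HasDerivAt (fun s => (invUV (U s, X s * Y s)).2) _ t := hdiff.snd.hasDerivAt
  rw [speed]
  set a := (invUV (U t, X t * Y t)).1 with hadef
  set b := (invUV (U t, X t * Y t)).2 with hbdef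
  set a' := deriv (fun s => (invUV (U s, X s * Y s)).1) t
  set b' := deriv (fun s => (invUV (U s, X s * Y s)).2) t
  have e1 : a * a' - b * b' = U' := by
    have h1 := ((ha.pow 2).sub (hb.pow 2)).div_const 2
    have h2 : (fun s =>
        ((invUV (U s, X s * Y s)).1 ^ 2 - (invUV (U s, X s * Y s)).2 ^ 2) / 2) = U :=
      funext fun s => ucoord_invUV (U s, X s * Y s)
    have h3 := (h1.congr_of_eventuallyEq (f₁ := U)
      (Eventually.of_forall fun s => (congrFun h2 s).symm)).unique hU
    simp only [Nat.cast_ofNat, Nat.add_one_sub_one, pow_one] at h3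
    rw [← h3]
    ring
  have e2 : a' * b + a * b' = X' * Y t + X t * Y' :=
    (ha.mul hb).unique (hV.congr_of_eventuallyEq (hVe.mono fun s hs => invUV_fst_mul_snd hs.le))
  have e3 : U' ^ 2 = (X t * X' - Y t * Y') ^ 2 := sq_eq_sq_iff_abs_eq_abs _ _ |>.2 hU'
  obtain ⟨hup, hlo⟩ := hd.deriv_bounds ht hX hY
  have hprod : (a' ^ 2 + b' ^ 2) * (a ^ 2 + b ^ 2)
      = (X' ^ 2 + Y' ^ 2) * (X t ^ 2 + Y t ^ 2) := by
    linear_combination (a * a' - b * b' + U') * e1 + e3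
      + (a' * b + a * b' + (X' * Y t + X t * Y')) * e2
  have hge : X t ^ 2 + Y t ^ 2 ≤ a ^ 2 + b ^ 2 := by
    have h1 : (X t ^ 2 + Y t ^ 2) / 2 ≤ √(U t ^ 2 + (X t * Y t) ^ 2) := by
      apply Real.le_sqrt_of_sq_le
      have := sq_le_sq' (by linarith [neg_abs_le ((X t ^ 2 - Y t ^ 2) / 2)])
        ((le_abs_self _).trans hUt)
      nlinarith
    have h2 := invUV_fst_sq (U t, X t * Y t)
    have h3 := invUV_snd_sq (U t, X t * Y t)
    simp only at h2 h3
    linarith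
  have hpos : 0 < X t ^ 2 + Y t ^ 2 := by
    nlinarith [sq_nonneg (X t - Y t)]
  have hXY' : 0 < X' ^ 2 + Y' ^ 2 := by
    nlinarith [sq_nonneg (X' - Y')]
  constructor
  · refine Real.sqrt_pos.2 (pos_of_mul_pos_left (b := a ^ 2 + b ^ 2) ?_ (by positivity))
    rw [hprod]
    positivity
  · refine Real.sqrt_le_iff.2 ⟨hL.le, ?_⟩
    have h1 : (a' ^ 2 + b' ^ 2) * (X t ^ 2 + Y t ^ 2) ≤ L ^ 2 * (X t ^ 2 + Y t ^ 2) :=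
      (mul_le_mul_of_nonneg_left hge (by positivity)).trans
        (hprod.le.trans (mul_le_mul_of_nonneg_right hup hpos.le))
    exact le_of_mul_le_mul_right h1 hpos

/-- A descent unfolds to a curve with the same product of coordinates along which `u` increases, and
whose speed does not exceed that of the descent. -/
theorem IsDescent.exists_unfolded {x0 y0 L : ℝ} {X Y : ℝ → ℝ} (hy0 : 0 < y0) (hyx : y0 ≤ x0)
    (hX : Continuous X) (hY : Continuous Y) (hL : 0 < L) (hd : IsDescent x0 y0 X Y L)
    (hpos : ∀ t ∈ Ico (0:ℝ) 1, 0 < X t ∧ 0 < Y t) :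
    ∃ α : ℝ → ℝ × ℝ, Continuous α ∧ α 0 = (x0, y0) ∧ (∀ t, α t ∈ Pset) ∧
      (∀ t ∈ Ico (0:ℝ) 1, α t ∈ Pint) ∧ α 1 ∈ Pbdry ∧
      (∀ a ∈ Ico (0:ℝ) 1, ∃ K, LipschitzOnWith K α (Icc 0 a)) ∧
      (∀ t ∈ Icc (0:ℝ) 1, (α t).1 * (α t).2 = X t * Y t) ∧
      MonotoneOn (fun t => ucoord (α t)) (Icc 0 1) ∧
      ∀ᵐ t, t ∈ Ioo (0:ℝ) 1 → 0 < speed α t ∧ speed α t ≤ L := by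
  have hx0 : 0 < x0 := hy0.trans_le hyx
  set U : ℝ → ℝ := fun t => (X t ^ 2 - Y t ^ 2) / 2 with hU
  set K : NNReal := (4 * L * (x0 + y0)).toNNReal with hK
  have hUl : LipschitzOnWith K U (Icc 0 1) := by
    refine hd.lipschitzOnWith_of_abs_sub_le hx0.le hy0.le hL.le fun s t => ?_
    have e : U s - U t = ((X s - X t) * (X s + X t) - (Y s - Y t) * (Y s + Y t)) / 2 := by
      simp only [hU]; ring
    rw [e, abs_div, abs_two, div_le_iff₀ two_pos]
    refine (abs_sub _ _).trans ?_
    rw [abs_mul, abs_mul]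
    have := mul_nonneg (abs_nonneg (X s - X t)) (abs_nonneg (X s + X t))
    have := mul_nonneg (abs_nonneg (X s - X t)) (abs_nonneg (Y s + Y t))
    have := mul_nonneg (abs_nonneg (Y s - Y t)) (abs_nonneg (X s + X t))
    have := mul_nonneg (abs_nonneg (Y s - Y t)) (abs_nonneg (Y s + Y t))
    linarith
  have hVl : LipschitzOnWith K (fun t => X t * Y t) (Icc 0 1) := by
    refine hd.lipschitzOnWith_of_abs_sub_le hx0.le hy0.le hL.le fun s t => ?_
    have e : X s * Y s - X t * Y t
        = ((X s - X t) * (Y s + Y t) + (Y s - Y t) * (X s + X t)) / 2 := by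
      ring
    rw [e, abs_div, abs_two, div_le_iff₀ two_pos]
    refine (abs_add_le _ _).trans ?_
    rw [abs_mul, abs_mul]
    have := mul_nonneg (abs_nonneg (X s - X t)) (abs_nonneg (X s + X t))
    have := mul_nonneg (abs_nonneg (X s - X t)) (abs_nonneg (Y s + Y t))
    have := mul_nonneg (abs_nonneg (Y s - Y t)) (abs_nonneg (X s + X t))
    have := mul_nonneg (abs_nonneg (Y s - Y t)) (abs_nonneg (Y s + Y t))
    linarith
  set q : ℝ → ℝ := indicator (Ioo 0 1) fun t => |deriv U t| with hq
  have hqm : Measurable q := (measurable_deriv U).abs.indicator measurableSet_Ioo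
  have hq0 : ∀ t, 0 ≤ q t := fun t => indicator_nonneg (fun _ _ => abs_nonneg _) t
  have hqK : ∀ t, |q t| ≤ K := by
    intro t
    rw [abs_of_nonneg (hq0 t)]
    refine indicator_le' (fun s hs => ?_) (fun _ _ => K.2) t
    exact norm_deriv_le_of_lipschitzOn (Icc_mem_nhds hs.1 hs.2) hUl
  have hqi : ∀ a b, IntervalIntegrable q volume a b := fun a b =>
    (intervalIntegrable_const (c := (K:ℝ))).mono_fun hqm.aestronglyMeasurable
      (Eventually.of_forall fun t => by simpa using hqK t)
  set W : ℝ → ℝ := fun t => (x0 ^ 2 - y0 ^ 2) / 2 + ∫ r in (0:ℝ)..t, q r with hW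
  have hWl : LipschitzWith K W := by
    have := lipschitzWith_primitive hqm hqK
    exact LipschitzWith.of_dist_le_mul fun s t => by
      simpa [hW] using this.dist_le_mul s t
  have hWmono : MonotoneOn W (Icc 0 1) := by
    intro s _ t _ hst
    simp only [hW]
    gcongr
    rw [← sub_nonneg, intervalIntegral.integral_interval_sub_left (hqi _ _) (hqi _ _)]
    exact intervalIntegral.integral_nonneg hst fun r _ => hq0 r
  have hUW : ∀ t ∈ Icc (0:ℝ) 1, |U t| ≤ W t := by
    intro t ht
    have hac : AbsolutelyContinuousOnInterval U 0 t := by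
      refine LipschitzOnWith.absolutelyContinuousOnInterval (K := K) (hUl.mono ?_)
      rw [uIcc_of_le ht.1]
      exact Icc_subset_Icc_right ht.2
    have h0 : U 0 = (x0 ^ 2 - y0 ^ 2) / 2 := by simp only [hU, hd.start_fst, hd.start_snd]
    have e := hac.integral_deriv_eq_sub
    have e2 : ∫ r in (0:ℝ)..t, |deriv U r| = ∫ r in (0:ℝ)..t, q r := by
      rw [intervalIntegral.integral_of_le ht.1, intervalIntegral.integral_of_le ht.1,
        integral_Ioc_eq_integral_Ioo, integral_Ioc_eq_integral_Ioo]
      refine setIntegral_congr_fun measurableSet_Ioo fun r hr => ?_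
      rw [hq, indicator_of_mem (Ioo_subset_Ioo_right ht.2 hr)]
    have e3 := intervalIntegral.abs_integral_le_integral_abs (f := deriv U) (μ := volume) ht.1
    rw [e, e2] at e3
    have h00 : 0 ≤ U 0 := by rw [h0]; nlinarith
    have e4 := abs_sub_abs_le_abs_sub (U t) (U 0)
    rw [abs_of_nonneg h00, h0] at e4
    rw [h0] at e3
    simp only [hW]
    linarith
  have hVpos : ∀ t ∈ Ico (0:ℝ) 1, 0 < X t * Y t := fun t ht => mul_pos (hpos t ht).1 (hpos t ht).2
  have hV0 : ∀ t ∈ Icc (0:ℝ) 1, 0 ≤ X t * Y t := fun t ht =>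
    mul_nonneg (hd.nonneg_fst t ht) (hd.nonneg_snd t ht)
  have hζ : Continuous fun t => (W t, X t * Y t) := hWl.continuous.prodMk (hX.mul hY)
  refine ⟨fun t => invUV (W t, X t * Y t), continuous_invUV.comp hζ, ?_, fun t =>
    ⟨invUV_fst_nonneg _, invUV_snd_nonneg _⟩, fun t ht => invUV_pos (hVpos t ht),
    ⟨⟨invUV_fst_nonneg _, invUV_snd_nonneg _⟩, mul_eq_zero.1 ?_⟩, fun a ha => ?_,
    fun t ht => invUV_fst_mul_snd (hV0 t ht), ?_, ?_⟩
  · simp only [hW, intervalIntegral.integral_same, add_zero, hd.start_fst, hd.start_snd]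
    exact invUV_ucoord_vcoord hx0.le hy0.le
  · rw [invUV_fst_mul_snd (hV0 1 ⟨zero_le_one, le_rfl⟩)]
    exact hd.end_eq
  · obtain ⟨C, hC⟩ := exists_lipschitzOnWith_invUV ((isCompact_Icc (a := 0) (b := a)).image hζ) (by
      rintro _ ⟨t, ht, rfl⟩
      exact hVpos t ⟨ht.1, ht.2.trans_lt ha.2⟩)
    exact ⟨_, hC.comp ((hWl.lipschitzOnWith).prodMk
      (hVl.mono (Icc_subset_Icc_right ha.2.le))) (mapsTo_image _ _)⟩
  · simpa only [ucoord_invUV] using hWmono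
  · have aeX : ∀ {G : ℝ → ℝ} {C : NNReal}, LipschitzOnWith C G (Icc 0 1) →
        ∀ᵐ t, t ∈ Ioo (0:ℝ) 1 → DifferentiableAt ℝ G t := by
      intro G C hG
      rw [← uIcc_of_le zero_le_one] at hG
      filter_upwards [hG.absolutelyContinuousOnInterval.ae_differentiableAt] with t ht htm
      refine ht ?_
      rw [uIcc_of_le zero_le_one]
      exact ⟨htm.1.le, htm.2.le⟩
    have hXl : LipschitzOnWith L.toNNReal X (Icc 0 1) :=
      LipschitzOnWith.of_dist_le_mul fun s hs t ht => by
        simpa only [Real.dist_eq, Real.coe_toNNReal _ hL.le] using (hd.abs_sub_le hL.le s hs t ht).1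
    have hYl : LipschitzOnWith L.toNNReal Y (Icc 0 1) :=
      LipschitzOnWith.of_dist_le_mul fun s hs t ht => by
        simpa only [Real.dist_eq, Real.coe_toNNReal _ hL.le] using (hd.abs_sub_le hL.le s hs t ht).2
    filter_upwards [aeX hXl, aeX hYl, (hqi 0 1).ae_hasDerivAt_integral] with t h1 h2 h3 ht
    have hXd := (h1 ht).hasDerivAt
    have hYd := (h2 ht).hasDerivAt
    have hUd : HasDerivAt U (X t * deriv X t - Y t * deriv Y t) t :=
      (((hXd.pow 2).sub (hYd.pow 2)).div_const 2).congr_deriv (by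
        simp only [Nat.cast_ofNat, Nat.add_one_sub_one, pow_one]; ring)
    rw [uIcc_of_le zero_le_one] at h3
    have hWd : HasDerivAt W (q t) t := (h3 ⟨ht.1.le, ht.2.le⟩ 0 (by simp)).const_add _
    refine speed_invUV hd hL ht (hVpos t ⟨ht.1.le, ht.2⟩) hXd hYd hWd ?_
      (hUW t ⟨ht.1.le, ht.2.le⟩)
    rw [hq, indicator_of_mem ht, hUd.deriv, abs_abs]

theorem Fvol_eq (n : ℕ) (cn : ℝ) (z : ℝ × ℝ) : Fvol n cn z = cn * (z.1 * z.2) ^ (n - 1) := by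
  rw [Fvol, mul_pow, mul_assoc]

theorem rpow_mul_rpow_one_sub {F s : ℝ} (p : ℝ) (hF : 0 < F) (hs : 0 ≤ s) :
    F ^ p * (F * s) ^ (1 - p) = F * s ^ (1 - p) := by
  rw [Real.mul_rpow hF.le hs, ← mul_assoc, ← Real.rpow_add hF]
  simp

theorem exists_lambdaH_test {n : ℕ} {cn p L : ℝ} {α : ℝ → ℝ × ℝ} (hcn : 0 < cn) (hp : 1 < p)
    (hL : 0 < L) (hαc : Continuous α) (hα : ∀ t ∈ Ico (0:ℝ) 1, α t ∈ Pint)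
    (hs : ∀ᵐ t, t ∈ Ioo (0:ℝ) 1 → 0 < speed α t ∧ speed α t ≤ L) :
    ∃ w : ℝ → ℝ, (∃ K, LipschitzOnWith K w (Icc 0 1)) ∧ w 0 = 0 ∧
      IntervalIntegrable (numH n cn p 0 1 (Ico 0 1) α w) volume 0 1 ∧
      IntervalIntegrable (denH n cn p (Ico 0 1) α w) volume 0 1 ∧
      0 < ∫ t in (0:ℝ)..1, denH n cn p (Ico 0 1) α w t := by
  classical
  set S : Set ℝ := {t | 0 < speed α t ∧ speed α t ≤ L}
  have hS : MeasurableSet S := (measurableSet_lt measurable_const (measurable_speed α)).inter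
    (measurableSet_le (measurable_speed α) measurable_const)
  set g : ℝ → ℝ := S.piecewise (speed α) fun _ => L with hg
  have hgm : Measurable g := (measurable_speed α).piecewise hS measurable_const
  have hgp : ∀ t, 0 < g t ∧ g t ≤ L := by
    intro t
    by_cases ht : t ∈ S
    · rw [hg, piecewise_eq_of_mem _ _ _ ht]
      exact ht
    · rw [hg, piecewise_eq_of_notMem _ _ _ ht]
      exact ⟨hL, le_rfl⟩
  have hgL : ∀ t, |g t| ≤ (L.toNNReal : NNReal) := fun t => by
    rw [abs_of_pos (hgp t).1, Real.coe_toNNReal _ hL.le]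
    exact (hgp t).2
  have hgi : ∀ a b, IntervalIntegrable g volume a b := fun a b =>
    (intervalIntegrable_const (c := L)).mono_fun hgm.aestronglyMeasurable
      (Eventually.of_forall fun t => by
        simpa [abs_of_pos (hgp t).1, abs_of_pos hL] using (hgp t).2)
  set w : ℝ → ℝ := fun t => ∫ r in (0:ℝ)..t, g r with hw
  have hwl : LipschitzWith _ w := lipschitzWith_primitive hgm hgL
  have hwpos : ∀ t ∈ Ioo (0:ℝ) 1, 0 < w t := fun t ht =>
    intervalIntegral.intervalIntegral_pos_of_pos (hgi _ _) (fun r => (hgp r).1) ht.1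
  have hFc : Continuous fun t => Fvol n cn (α t) := (continuous_Fvol n cn).comp hαc
  have hgI := (hgi 0 1).mul_continuousOn hFc.continuousOn
  have hwI : IntervalIntegrable (fun t => g t * Fvol n cn (α t) * |w t| ^ p) volume 0 1 :=
    hgI.mul_continuousOn
      ((hwl.continuous.abs).rpow_const fun _ => Or.inr (by linarith)).continuousOn
  have hnum : (fun t => g t * Fvol n cn (α t)) =ᵐ[volume.restrict (uIoc 0 1)]
      numH n cn p 0 1 (Ico 0 1) α w := by
    rw [uIoc_of_le zero_le_one, ← restrict_Ioo_eq_restrict_Ioc]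
    filter_upwards [ae_restrict_mem measurableSet_Ioo,
      ae_restrict_of_ae (ae_derivWithin_primitive hgm hgL), ae_restrict_of_ae hs] with t htm ht hst
    have hF := Fvol_pos (n := n) hcn (hα t ⟨htm.1.le, htm.2⟩)
    have hgs : g t = speed α t := by rw [hg, piecewise_eq_of_mem _ _ _ (show t ∈ S from hst htm)]
    rw [numH, ht htm, hSpeedOn_Ico_eq _ _ _ htm, mul_assoc,
      rpow_mul_rpow_one_sub p hF (speed_nonneg α t), ← hgs, abs_of_pos (hgp t).1, mul_left_comm,
      ← Real.rpow_add (hgp t).1]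
    simp [mul_comm]
  have hden : (fun t => g t * Fvol n cn (α t) * |w t| ^ p) =ᵐ[volume.restrict (uIoc 0 1)]
      denH n cn p (Ico 0 1) α w := by
    rw [uIoc_of_le zero_le_one, ← restrict_Ioo_eq_restrict_Ioc]
    filter_upwards [ae_restrict_mem measurableSet_Ioo, ae_restrict_of_ae hs] with t htm hst
    have hgs : g t = speed α t := by rw [hg, piecewise_eq_of_mem _ _ _ (show t ∈ S from hst htm)]
    rw [denH, hSpeedOn_Ico_eq _ _ _ htm, ← hgs]
    ring
  refine ⟨w, ⟨_, hwl.lipschitzOnWith⟩, by simp [hw], hgI.congr_ae hnum, hwI.congr_ae hden, ?_⟩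
  rw [← intervalIntegral.integral_congr_ae_restrict hden]
  refine intervalIntegral.intervalIntegral_pos_of_pos_on hwI (fun t ht => ?_) one_pos
  have hF := Fvol_pos (n := n) hcn (hα t ⟨ht.1.le, ht.2⟩)
  have := (hgp t).1
  have := Real.rpow_pos_of_pos (abs_pos.2 (hwpos t ht).ne') p
  positivity

/-- The eigenvalue of a curve with speed at most `L` and coordinate product `X Y` is at least every
constant in the Hardy inequality along `X, Y`. -/
theorem HardyIneq.le_lambdaH {n : ℕ} {cn p L c : ℝ} {X Y : ℝ → ℝ} {α : ℝ → ℝ × ℝ} (hcn : 0 < cn)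
    (hp : 1 < p) (hL : 0 < L) (hX : Continuous X) (hY : Continuous Y) (hαc : Continuous α)
    (hα : ∀ t ∈ Ico (0:ℝ) 1, α t ∈ Pint)
    (hV : ∀ t ∈ Icc (0:ℝ) 1, (α t).1 * (α t).2 = X t * Y t)
    (hs : ∀ᵐ t, t ∈ Ioo (0:ℝ) 1 → 0 < speed α t ∧ speed α t ≤ L) (hc : 0 ≤ c)
    (h : HardyIneq n p X Y L c) : c ≤ lambdaH n cn p α := by
  obtain ⟨w₀, hw₀⟩ := exists_lambdaH_test (n := n) hcn hp hL hαc hα hs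
  refine le_csInf ⟨_, w₀, hw₀.1, hw₀.2.1, hw₀.2.2.1, hw₀.2.2.2.1, hw₀.2.2.2.2, rfl⟩ ?_
  rintro _ ⟨w, ⟨K, hK⟩, hw0, hN, hD, hDpos, rfl⟩
  rw [le_div_iff₀ hDpos]
  set f : ℝ → ℝ := indicator (Ioo 0 1) (deriv w) with hf
  have hfm : Measurable f := (measurable_deriv w).indicator measurableSet_Ioo
  have hfK : ∀ t, |f t| ≤ K := by
    intro t
    by_cases ht : t ∈ Ioo (0:ℝ) 1
    · rw [hf, indicator_of_mem ht]
      exact norm_deriv_le_of_lipschitzOn (Icc_mem_nhds ht.1 ht.2) hK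
    · rw [hf, indicator_of_notMem ht, abs_zero]
      exact K.2
  have hfw : ∀ t ∈ Icc (0:ℝ) 1, ∫ r in (0:ℝ)..t, f r = w t := by
    intro t ht
    have hac : AbsolutelyContinuousOnInterval w 0 t := by
      refine LipschitzOnWith.absolutelyContinuousOnInterval (K := K) (hK.mono ?_)
      rw [uIcc_of_le ht.1]
      exact Icc_subset_Icc_right ht.2
    have hFTC := hac.integral_deriv_eq_sub
    rw [hw0, sub_zero] at hFTC
    rw [← hFTC, intervalIntegral.integral_of_le ht.1, intervalIntegral.integral_of_le ht.1,
      integral_Ioc_eq_integral_Ioo, integral_Ioc_eq_integral_Ioo]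
    refine setIntegral_congr_fun measurableSet_Ioo fun r hr => ?_
    rw [hf, indicator_of_mem (Ioo_subset_Ioo_right ht.2 hr)]
  set W : ℝ → ℝ := fun t => ∫ r in (0:ℝ)..t, f r
  have hWc : Continuous W := (lipschitzWith_primitive hfm hfK).continuous
  have hVc : Continuous fun t => (X t * Y t) ^ (n - 1) := (hX.mul hY).pow _
  have hNi : IntervalIntegrable (fun t => |f t| ^ p * (X t * Y t) ^ (n - 1)) volume 0 1 :=
    (intervalIntegrable_abs_rpow (by linarith) hfm fun t _ => hfK t).mul_continuousOn
      hVc.continuousOn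
  have hDi : IntervalIntegrable (fun t => |W t| ^ p * (X t * Y t) ^ (n - 1)) volume 0 1 :=
    (intervalIntegrable_abs_rpow (by linarith) hWc.measurable fun t ht =>
      bounded_primitive hfK t ⟨ht.1.le, ht.2.le⟩).mul_continuousOn hVc.continuousOn
  have hnum : cn * L ^ (1 - p) * (∫ t in (0:ℝ)..1, |f t| ^ p * (X t * Y t) ^ (n - 1))
      ≤ ∫ t in (0:ℝ)..1, numH n cn p 0 1 (Ico 0 1) α w t := by
    rw [← intervalIntegral.integral_const_mul]
    refine intervalIntegral.integral_mono_ae_restrict zero_le_one (hNi.const_mul _) hN ?_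
    rw [← restrict_Ioo_eq_restrict_Icc]
    filter_upwards [ae_restrict_mem measurableSet_Ioo, ae_restrict_of_ae hs] with t ht hst
    have hF := Fvol_pos (n := n) hcn (hα t ⟨ht.1.le, ht.2⟩)
    rw [numH, hSpeedOn_Ico_eq _ _ _ ht, mul_assoc (|_| ^ p),
      rpow_mul_rpow_one_sub p hF (speed_nonneg α t),
      derivWithin_of_mem_nhds (Icc_mem_nhds ht.1 ht.2), hf, indicator_of_mem ht]
    have hle : L ^ (1 - p) ≤ speed α t ^ (1 - p) :=
      Real.rpow_le_rpow_of_nonpos (hst ht).1 (hst ht).2 (by linarith)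
    calc _ = |deriv w t| ^ p * (Fvol n cn (α t) * L ^ (1 - p)) := by
          rw [Fvol_eq, hV t ⟨ht.1.le, ht.2.le⟩]
          ring
      _ ≤ _ := by gcongr
  have hden : ∫ t in (0:ℝ)..1, denH n cn p (Ico 0 1) α w t
      ≤ cn * L * ∫ t in (0:ℝ)..1, |W t| ^ p * (X t * Y t) ^ (n - 1) := by
    rw [← intervalIntegral.integral_const_mul]
    refine intervalIntegral.integral_mono_ae_restrict zero_le_one hD (hDi.const_mul _) ?_
    rw [← restrict_Ioo_eq_restrict_Icc]
    filter_upwards [ae_restrict_mem measurableSet_Ioo, ae_restrict_of_ae hs] with t ht hst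
    have hF := Fvol_pos (n := n) hcn (hα t ⟨ht.1.le, ht.2⟩)
    rw [denH, hSpeedOn_Ico_eq _ _ _ ht, ← hfw t ⟨ht.1.le, ht.2.le⟩]
    calc _ ≤ |W t| ^ p * (Fvol n cn (α t) * L) := by
          gcongr
          exact (hst ht).2
      _ = _ := by
          rw [Fvol_eq, hV t ⟨ht.1.le, ht.2.le⟩]
          ring
  have hLL : L ^ (1 - p) * L ^ p = L := by
    rw [← Real.rpow_add hL]
    simp
  calc _ ≤ c * (cn * L * ∫ t in (0:ℝ)..1, |W t| ^ p * (X t * Y t) ^ (n - 1)) := by gcongr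
    _ = cn * L ^ (1 - p) * (c * L ^ p * ∫ t in (0:ℝ)..1, |W t| ^ p * (X t * Y t) ^ (n - 1)) := by
        nth_rewrite 1 [← hLL]
        ring
    _ ≤ cn * L ^ (1 - p) * ∫ t in (0:ℝ)..1, |f t| ^ p * (X t * Y t) ^ (n - 1) := by
        gcongr
        exact h f hfm ⟨K, hfK⟩
    _ ≤ _ := hnum

theorem memRhPlus_of_speed_le {n : ℕ} {cn x0 y0 L : ℝ} {α : ℝ → ℝ × ℝ} (hcn : 0 < cn)
    (hαc : Continuous α) (h0 : α 0 = (x0, y0)) (hP : ∀ t, α t ∈ Pset)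
    (hα : ∀ t ∈ Ico (0:ℝ) 1, α t ∈ Pint) (h1 : α 1 ∈ Pbdry)
    (hlip : ∀ a ∈ Ico (0:ℝ) 1, ∃ K, LipschitzOnWith K α (Icc 0 a))
    (hs : ∀ᵐ t, t ∈ Ioo (0:ℝ) 1 → speed α t ≤ L) : MemRhPlus n cn x0 y0 α := by
  refine ⟨hαc.continuousOn, fun t _ => hP t, h1, h0, hα, hlip, ?_, ?_⟩
  · obtain ⟨B, hB⟩ := (isCompact_Icc (a := (0:ℝ)) (b := 1)).bddAbove_image
      ((continuous_Fvol n cn).comp hαc).continuousOn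
    refine ⟨B * L, ?_⟩
    filter_upwards [hs, compl_mem_ae_iff.2 (measure_singleton (0:ℝ))] with t ht ht0 htm
    have htI : t ∈ Ioo (0:ℝ) 1 := ⟨htm.1.lt_of_ne' ht0, htm.2⟩
    have hF := Fvol_pos (n := n) hcn (hα t htm)
    have hFB : Fvol n cn (α t) ≤ B := hB ⟨t, ⟨htm.1, htm.2.le⟩, rfl⟩
    rw [hSpeed, hSpeedOn_Ico_eq _ _ _ htI]
    exact mul_le_mul hFB (ht htI) (speed_nonneg α t) (hF.le.trans hFB)
  · have hc : Continuous fun t => (α t).1 * (α t).2 := by fun_prop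
    rw [← mul_eq_zero.2 h1.2]
    exact hc.continuousAt.tendsto.mono_left nhdsWithin_le_nhds

/-- For `p ≥ 2n-1` there is a curve `α ∈ R_h^+` attaining
`Λ_p = sup{λ_{1,p}(γ) : γ ∈ R_h}` such that `u ∘ α` is monotonically increasing
on `[0,1]`. -/
theorem simons_stmt8 (n : ℕ) (hn : 2 ≤ n) (cn : ℝ) (hcn : 0 < cn)
    (x0 y0 : ℝ) (hy0 : 0 < y0) (hxy : y0 ≤ x0)
    (p : ℝ) (hp : 2 * (n : ℝ) - 1 ≤ p) :
    ∃ α : ℝ → ℝ × ℝ, MemRhPlus n cn x0 y0 α ∧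
      (∀ γ : ℝ → ℝ × ℝ, MemRh n cn x0 y0 γ → lambdaH n cn p γ ≤ lambdaH n cn p α) ∧
      MonotoneOn (fun t => ucoord (α t)) (Icc 0 1) := by
  have hx0 : 0 < x0 := hy0.trans_le hxy
  have hp1 : 1 < p := by
    have : (2:ℝ) ≤ n := by exact_mod_cast hn
    linarith
  obtain ⟨X, Y, L, hX, hY, hL, hd, hopt⟩ :=
    exists_optimal_isDescent n (zero_lt_one.trans hp1) hx0 hy0
  obtain ⟨T, hT0, hT1, hLpos, hdT, hpos⟩ := hd.exists_pos_on_Ico hx0 hy0 hX hY hL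
  have hXT : Continuous fun t => X (T * t) := hX.comp (continuous_const_mul T)
  have hYT : Continuous fun t => Y (T * t) := hY.comp (continuous_const_mul T)
  obtain ⟨α, hαc, h0, hP, hα, h1, hlip, hV, hmono, hs⟩ :=
    hdT.exists_unfolded hy0 hxy hXT hYT (mul_pos hLpos hT0) hpos
  refine ⟨α, memRhPlus_of_speed_le hcn hαc h0 hP hα h1 hlip
    (hs.mono fun t ht htm => (ht htm).2), fun γ hγ => ?_, hmono⟩
  have hnn := (lambdaH_nonneg (n := n) (p := p) hcn hγ.2.1).1
  exact ((hopt _ (hγ.exists_isDescent hcn hp1 hx0 hy0)).comp_mul_left (zero_lt_one.trans hp1)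
    hX hY hL hd hnn hT0 hT1).le_lambdaH hcn hp1 (mul_pos hLpos hT0) hXT hYT hαc hα hV hs hnn
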